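/- arXiv:math/0307221 — 2 statements merged into one kernel-verified Lean document; each statement's English description precedes it below -/
import Mathlib

section
/- Let K be a quadratic number field with Dedekind zeta function ζ_K. For every fixed ε > 0, one has ζ_K(σ + it) ≪_{K,ε} 1 + |t|^{(5/6)(1-σ) + ε}, uniformly for σ ≥ 1/2 and |t| ≥ 1. -/
open Complex Filter Asymptotics

/-- `rK K n` is the number of nonzero integral ideals of the ring of integers of `K`
of absolute norm `n`. -/
noncomputable def rK (K : Type*) [Field K] [NumberField K] (n : ℕ) : ℕ :=
  Nat.card {I : Ideal (NumberField.RingOfIntegers K) // Ideal.absNorm I = n ∧ I ≠ ⊥}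

lemma norm_exp_mul_I_sub_one_ge {g : ℝ} (h0 : 0 ≤ g) (h1 : g ≤ Real.pi) :
    2 / Real.pi * g ≤ ‖exp (g * I) - 1‖ := by
  have h : ‖exp (g * I) - 1‖ = ‖2 * Real.sin (g / 2)‖ := by
    rw [mul_comm (g : ℂ) I]; exact Complex.norm_exp_I_mul_ofReal_sub_one g
  rw [h, Real.norm_eq_abs]
  have := Real.mul_le_sin (x := g / 2) (by linarith) (by linarith)
  calc 2 / Real.pi * g = 2 * (2 / Real.pi * (g / 2)) := by ring
    _ ≤ 2 * Real.sin (g / 2) := by linarith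
    _ ≤ _ := le_abs_self _

lemma norm_exp_mul_I_sub_exp_le (x y : ℝ) : ‖exp (x * I) - exp (y * I)‖ ≤ |x - y| := by
  have : exp (x * I) - exp (y * I) = exp (y * I) * (exp (I * ((x - y : ℝ) : ℂ)) - 1) := by
    rw [mul_sub, ← Complex.exp_add, mul_one]
    congr 2
    push_cast; ring
  rw [this, norm_mul, norm_exp_ofReal_mul_I, one_mul]
  exact Real.norm_exp_I_mul_ofReal_sub_one_le

/-- The Kusmin–Landau inequality for phases with antitone increments in `(0, π]`. -/
lemma norm_sum_exp_le_of_antitone (x : ℕ → ℝ) (A B : ℕ) (hAB : A ≤ B)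
    (hpos : ∀ n ∈ Finset.Icc A B, 0 < x (n + 1) - x n)
    (hpi : ∀ n ∈ Finset.Icc A B, x (n + 1) - x n ≤ Real.pi)
    (hanti : ∀ n ∈ Finset.Ico A B, x (n + 2) - x (n + 1) ≤ x (n + 1) - x n) :
    ‖∑ n ∈ Finset.Ico A B, exp (x n * I)‖ ≤ 16 / (x (B + 1) - x B) := by
  set g : ℕ → ℝ := fun n => x (n + 1) - x n with hg
  set c : ℕ → ℂ := fun n => (1 - exp (g n * I))⁻¹ with hc
  have hpi4 := Real.pi_lt_d2
  have hpi0 := Real.pi_pos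
  have hlow : ∀ n ∈ Finset.Icc A B, g n / 2 ≤ ‖1 - exp (g n * I)‖ := by
    intro n hn
    have h := norm_exp_mul_I_sub_one_ge (hpos n hn).le (hpi n hn)
    rw [norm_sub_rev]
    refine le_trans ?_ h
    rw [div_mul_eq_mul_div, div_le_div_iff₀ (by norm_num) hpi0]
    have : 0 < g n := hpos n hn
    change g n * Real.pi ≤ 2 * g n * 2
    nlinarith
  have hne : ∀ n ∈ Finset.Icc A B, 1 - exp (g n * I) ≠ 0 := by
    intro n hn h
    have := hlow n hn
    rw [h, norm_zero] at this
    have : 0 < g n := hpos n hn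
    linarith
  have hcn : ∀ n ∈ Finset.Icc A B, ‖c n‖ ≤ 2 / g n := by
    intro n hn
    have h0 : 0 < g n := hpos n hn
    rw [hc, norm_inv, ← inv_div]
    exact inv_anti₀ (by positivity) (hlow n hn)
  have hz : ∀ n, exp (x (n + 1) * I) = exp (x n * I) * exp (g n * I) := by
    intro n
    rw [← Complex.exp_add]; congr 1; simp [hg]; ring
  have hdiff : ∀ n ∈ Finset.Ico A B, ‖c (n + 1) - c n‖ ≤ 4 * (1 / g (n + 1) - 1 / g n) := by
    intro n hn
    rw [Finset.mem_Ico] at hn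
    have m1 : n ∈ Finset.Icc A B := Finset.mem_Icc.2 ⟨hn.1, hn.2.le⟩
    have m2 : n + 1 ∈ Finset.Icc A B := Finset.mem_Icc.2 ⟨by omega, by omega⟩
    have h0 : 0 < g n := hpos n m1
    have h1 : 0 < g (n + 1) := hpos _ m2
    have h2 : g (n + 1) ≤ g n := hanti n (Finset.mem_Ico.2 hn)
    have e : c (n + 1) - c n = c (n + 1) * (exp (g (n + 1) * I) - exp (g n * I)) * c n := by
      have e0 : c n * (1 - exp (g n * I)) = 1 := inv_mul_cancel₀ (hne n m1)
      have e1 : c (n + 1) * (1 - exp (g (n + 1) * I)) = 1 := inv_mul_cancel₀ (hne _ m2)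
      linear_combination (-c (n + 1)) * e0 + c n * e1
    rw [e, norm_mul, norm_mul]
    calc _ ≤ 2 / g (n + 1) * |g (n + 1) - g n| * (2 / g n) := by
          gcongr
          · exact hcn _ m2
          · exact norm_exp_mul_I_sub_exp_le _ _
          · exact hcn _ m1
      _ = _ := by rw [abs_of_nonpos (by linarith)]; field_simp; ring
  have key : ∀ b, A ≤ b → b ≤ B →
      ‖∑ n ∈ Finset.Ico A b, exp (x n * I) - c A * exp (x A * I) + c b * exp (x b * I)‖
        ≤ 4 * (1 / g b - 1 / g A) := by
    intro b hb
    induction b, hb using Nat.le_induction with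
    | base => intro _; simp
    | succ b hb ih =>
      intro hbB
      have ih := ih (by omega)
      have hd := hdiff b (Finset.mem_Ico.2 ⟨hb, by omega⟩)
      have hcb : c b * (1 - exp (g b * I)) = 1 :=
        inv_mul_cancel₀ (hne b (Finset.mem_Icc.2 ⟨hb, by omega⟩))
      rw [Finset.sum_Ico_succ_top hb]
      have e : ∑ n ∈ Finset.Ico A b, exp (x n * I) + exp (x b * I) - c A * exp (x A * I)
          + c (b + 1) * exp (x (b + 1 : ℕ) * I) =
          (∑ n ∈ Finset.Ico A b, exp (x n * I) - c A * exp (x A * I) + c b * exp (x b * I))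
          + (c (b + 1) - c b) * exp (x (b + 1 : ℕ) * I) := by
        rw [hz b]; linear_combination (-exp (x b * I)) * hcb
      rw [e]
      refine (norm_add_le _ _).trans ?_
      rw [norm_mul, norm_exp_ofReal_mul_I]
      linarith
  have hB := key B hAB le_rfl
  have mA : A ∈ Finset.Icc A B := Finset.mem_Icc.2 ⟨le_rfl, hAB⟩
  have mB : B ∈ Finset.Icc A B := Finset.mem_Icc.2 ⟨hAB, le_rfl⟩
  have hgB : 0 < g B := hpos B mB
  have hgA : 0 < g A := hpos A mA
  have hBA : ∀ b, A ≤ b → b ≤ B → g b ≤ g A := by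
    intro b hb
    induction b, hb using Nat.le_induction with
    | base => intro _; simp
    | succ b hb ih =>
      intro h
      exact (hanti b (Finset.mem_Ico.2 ⟨hb, by omega⟩)).trans (ih (by omega))
  have hgg := hBA B hAB le_rfl
  have e : ∑ n ∈ Finset.Ico A B, exp (x n * I) =
      (∑ n ∈ Finset.Ico A B, exp (x n * I) - c A * exp (x A * I) + c B * exp (x B * I))
      + c A * exp (x A * I) - c B * exp (x B * I) := by ring
  rw [e]
  refine (norm_sub_le _ _).trans ((add_le_add_left (norm_add_le _ _) _).trans ?_)
  rw [norm_mul, norm_mul, norm_exp_ofReal_mul_I, norm_exp_ofReal_mul_I, mul_one, mul_one]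
  have h1 := hcn A mA
  have h2 := hcn B mB
  have h3 : 1 / g A ≤ 1 / g B := one_div_le_one_div_of_le hgB hgg
  have h4 : 0 < 1 / g A := by positivity
  have e1 : 2 / g A = 2 * (1 / g A) := by ring
  have e2 : 2 / g B = 2 * (1 / g B) := by ring
  have e3 : 16 / (x (B + 1) - x B) = 16 * (1 / g B) := by simp only [hg]; ring
  rw [e3]; linarith

lemma sum_dist_le (r : ℕ → ℝ) (hr : ∀ n, 0 ≤ r n) (H k : ℕ) (hk : k < H) :
    ∑ j ∈ Finset.range H, r ((j - k) + (k - j)) ≤ r 0 + 2 * ∑ h ∈ Finset.Ico 1 H, r h := by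
  have h1 : ∑ j ∈ Finset.range H, r ((j - k) + (k - j)) =
      ∑ j ∈ Finset.range k, r ((j - k) + (k - j)) + ∑ j ∈ Finset.Ico k H, r ((j - k) + (k - j)) :=
    (Finset.sum_range_add_sum_Ico _ hk.le).symm
  rw [h1, Finset.sum_eq_sum_Ico_succ_bot hk]
  have h2 : ∑ j ∈ Finset.range k, r ((j - k) + (k - j)) ≤ ∑ h ∈ Finset.Ico 1 H, r h := by
    rw [← Finset.sum_range_reflect]
    calc _ = ∑ j ∈ Finset.range k, r (j + 1) := by
          refine Finset.sum_congr rfl fun j hj => ?_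
          rw [Finset.mem_range] at hj
          congr 1; omega
      _ = ∑ j ∈ Finset.Ico 1 (k + 1), r j := by
          rw [Finset.range_eq_Ico, Finset.sum_Ico_add' r 0 k 1]
      _ ≤ _ := Finset.sum_le_sum_of_subset_of_nonneg
          (Finset.Ico_subset_Ico le_rfl hk) (fun _ _ _ => hr _)
  have h3 : ∑ j ∈ Finset.Ico (k + 1) H, r ((j - k) + (k - j)) ≤ ∑ h ∈ Finset.Ico 1 H, r h := by
    calc _ = ∑ j ∈ Finset.Ico (1 + k) (H - k + k), r (j - k) := by
          rw [Nat.sub_add_cancel hk.le, add_comm 1 k]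
          refine Finset.sum_congr rfl fun j hj => ?_
          rw [Finset.mem_Ico] at hj
          congr 1; omega
      _ = ∑ j ∈ Finset.Ico 1 (H - k), r j := by
          rw [← Finset.sum_Ico_add' (fun j => r (j - k))]
          simp
      _ ≤ _ := Finset.sum_le_sum_of_subset_of_nonneg
          (Finset.Ico_subset_Ico le_rfl (by omega)) (fun _ _ _ => hr _)
  simp only [tsub_self, add_zero] at *
  linarith

/-- The Weyl–van der Corput inequality. -/
lemma sq_norm_sum_exp_le (x : ℕ → ℝ) (A B : ℕ) (hAB : A ≤ B) (H : ℕ) (hH : 1 ≤ H) :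
    ‖∑ n ∈ Finset.Ico A B, exp (x n * I)‖ ^ 2 ≤
      (((B - A : ℕ) + H : ℝ) / H) * ((B - A : ℕ) + 2 * ∑ h ∈ Finset.Ico 1 H,
        ‖∑ n ∈ Finset.Ico A (B - h), exp ((x (n + h) - x n : ℝ) * I)‖) := by
  set S := ∑ n ∈ Finset.Ico A B, exp (x n * I) with hS
  set y : ℕ → ℂ := fun n => if A + H ≤ n ∧ n < B + H then exp (x (n - H) * I) else 0 with hy
  set r : ℕ → ℝ := fun h => ‖∑ n ∈ Finset.Ico A (B - h), exp ((x (n + h) - x n : ℝ) * I)‖ with hr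
  set J := Finset.Ico (A + 1) (B + H) with hJ
  set u : ℕ → ℂ := fun m => ∑ j ∈ Finset.range H, y (m + j) with hu
  have hcorr : ∀ h k, k < H →
      ∑ m ∈ J, y (m + k + h) * (starRingEnd ℂ) (y (m + k)) =
        ∑ n ∈ Finset.Ico A (B - h), exp ((x (n + h) - x n : ℝ) * I) := by
    intro h k hk
    have e1 : ∑ m ∈ J, y (m + k + h) * (starRingEnd ℂ) (y (m + k)) =
        ∑ m ∈ Finset.Ico (A + 1 + k) (B + H + k), y (m + h) * (starRingEnd ℂ) (y m) := by
      rw [hJ, Finset.sum_Ico_add' (fun m => y (m + h) * (starRingEnd ℂ) (y m))]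
    have e2 : ∑ n ∈ Finset.Ico A (B - h), exp ((x (n + h) - x n : ℝ) * I) =
        ∑ m ∈ Finset.Ico (A + H) (B - h + H), y (m + h) * (starRingEnd ℂ) (y m) := by
      rw [← Finset.sum_Ico_add' (fun m => y (m + h) * (starRingEnd ℂ) (y m))]
      refine Finset.sum_congr rfl fun n hn => ?_
      rw [Finset.mem_Ico] at hn
      simp only [hy]
      rw [if_pos (by omega), if_pos (by omega)]
      rw [show n + H + h - H = n + h by omega, show n + H - H = n by omega, ← Complex.exp_conj,
        ← Complex.exp_add]
      congr 1
      simp; ring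
    rw [e1, e2]
    symm
    refine Finset.sum_subset (fun m hm => ?_) (fun m _ hm => ?_)
    · rw [Finset.mem_Ico] at hm ⊢; omega
    · rw [Finset.mem_Ico] at hm
      simp only [hy]
      by_cases h1 : A + H ≤ m + h ∧ m + h < B + H
      · rw [if_neg (c := A + H ≤ m ∧ m < B + H) (by omega)]; simp
      · rw [if_neg h1]; simp
  have hsum : ∑ m ∈ J, u m = H * S := by
    simp only [hu]
    rw [Finset.sum_comm]
    have : ∀ j ∈ Finset.range H, ∑ m ∈ J, y (m + j) = S := by
      intro j hj
      rw [Finset.mem_range] at hj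
      rw [hJ, Finset.sum_Ico_add' y]
      have e2 : S = ∑ m ∈ Finset.Ico (A + H) (B + H), y m := by
        rw [← Finset.sum_Ico_add' y, hS]
        refine Finset.sum_congr rfl fun n hn => ?_
        rw [Finset.mem_Ico] at hn
        simp only [hy]
        rw [if_pos (by omega), show n + H - H = n by omega]
      rw [e2]
      symm
      refine Finset.sum_subset (fun m hm => ?_) (fun m _ hm => ?_)
      · rw [Finset.mem_Ico] at hm ⊢; omega
      · rw [Finset.mem_Ico] at hm
        simp only [hy]
        rw [if_neg (by omega)]
    rw [Finset.sum_congr rfl this]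
    simp
  have hsq : ∑ m ∈ J, ‖u m‖ ^ 2 ≤ H * (r 0 + 2 * ∑ h ∈ Finset.Ico 1 H, r h) := by
    have e : ((∑ m ∈ J, ‖u m‖ ^ 2 : ℝ) : ℂ) =
        ∑ k ∈ Finset.range H, ∑ j ∈ Finset.range H,
          ∑ m ∈ J, y (m + j) * (starRingEnd ℂ) (y (m + k)) := by
      push_cast
      have : ∀ m ∈ J, ((‖u m‖ : ℂ)) ^ 2 = ∑ k ∈ Finset.range H, ∑ j ∈ Finset.range H,
          y (m + j) * (starRingEnd ℂ) (y (m + k)) := by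
        intro m _
        rw [← Complex.mul_conj', hu, map_sum, Finset.sum_mul_sum, Finset.sum_comm]
      rw [Finset.sum_congr rfl this, Finset.sum_comm]
      refine Finset.sum_congr rfl fun k _ => ?_
      rw [Finset.sum_comm]
    have e' : ∑ m ∈ J, ‖u m‖ ^ 2 = ‖((∑ m ∈ J, ‖u m‖ ^ 2 : ℝ) : ℂ)‖ := by
      rw [Complex.norm_real, Real.norm_of_nonneg (Finset.sum_nonneg fun _ _ => by positivity)]
    rw [e', e]
    calc _ ≤ ∑ k ∈ Finset.range H, ∑ j ∈ Finset.range H,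
          ‖∑ m ∈ J, y (m + j) * (starRingEnd ℂ) (y (m + k))‖ :=
          (norm_sum_le _ _).trans (Finset.sum_le_sum fun k _ => norm_sum_le _ _)
      _ = ∑ k ∈ Finset.range H, ∑ j ∈ Finset.range H, r ((j - k) + (k - j)) := by
          refine Finset.sum_congr rfl fun k hk => Finset.sum_congr rfl fun j hj => ?_
          rw [Finset.mem_range] at hk hj
          rcases le_total k j with h | h
          · obtain ⟨i, rfl⟩ := Nat.exists_eq_add_of_le h
            rw [show k + i - k + (k - (k + i)) = i by omega, hr]
            simp only
            rw [← hcorr i k hk]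
            simp only [add_assoc]
          · obtain ⟨i, rfl⟩ := Nat.exists_eq_add_of_le h
            rw [show j - (j + i) + (j + i - j) = i by omega, hr]
            simp only
            rw [← hcorr i j hj, ← Complex.norm_conj, map_sum]
            congr 1
            refine Finset.sum_congr rfl fun m _ => ?_
            rw [map_mul, Complex.conj_conj, mul_comm, add_assoc]
      _ ≤ ∑ k ∈ Finset.range H, (r 0 + 2 * ∑ h ∈ Finset.Ico 1 H, r h) :=
          Finset.sum_le_sum fun k hk => sum_dist_le r (fun _ => norm_nonneg _) H k
            (Finset.mem_range.1 hk)
      _ = _ := by rw [Finset.sum_const, Finset.card_range, nsmul_eq_mul]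
  have hr0 : r 0 = (B - A : ℕ) := by
    simp [hr]
  have hcard : ((J.card : ℕ) : ℝ) ≤ (B - A : ℕ) + H := by
    rw [hJ, Nat.card_Ico]
    exact_mod_cast (by omega)
  have hHpos : (0 : ℝ) < H := by exact_mod_cast hH
  have hcs : ‖∑ m ∈ J, u m‖ ^ 2 ≤ J.card * ∑ m ∈ J, ‖u m‖ ^ 2 :=
    (pow_le_pow_left₀ (norm_nonneg _) (norm_sum_le _ _) 2).trans sq_sum_le_card_mul_sum_sq
  have hfin : (H * ‖S‖) ^ 2 ≤ ((B - A : ℕ) + H) * (H * (r 0 + 2 * ∑ h ∈ Finset.Ico 1 H, r h)) := by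
    calc (H * ‖S‖) ^ 2 = ‖∑ m ∈ J, u m‖ ^ 2 := by rw [hsum, norm_mul, Complex.norm_natCast]
      _ ≤ _ := hcs
      _ ≤ _ := by gcongr
  rw [hr0] at hfin
  rw [div_mul_eq_mul_div, le_div_iff₀ hHpos]
  have : H * (‖S‖ ^ 2 * H) ≤ H * (((B - A : ℕ) + H) * ((B - A : ℕ) + 2 * ∑ h ∈ Finset.Ico 1 H, r h)) := by
    calc _ = (H * ‖S‖) ^ 2 := by ring
      _ ≤ _ := hfin
      _ = _ := by ring
  exact le_of_mul_le_mul_left this hHpos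

lemma exists_diff_eq {f f' : ℝ → ℝ} (hf : ∀ x > 0, HasDerivAt f (f' x) x) {y h : ℝ}
    (hy : 0 < y) (hh : 0 ≤ h) : ∃ ξ, y ≤ ξ ∧ ξ ≤ y + h ∧ f (y + h) - f y = h * f' ξ := by
  rcases hh.eq_or_lt with rfl | hh
  · exact ⟨y, le_rfl, by simp, by simp⟩
  · obtain ⟨ξ, hξ, e⟩ := exists_hasDerivAt_eq_slope f f' (show y < y + h by linarith)
      (fun x hx => (hf x (hy.trans_le hx.1)).continuousAt.continuousWithinAt)
      (fun x hx => hf x (hy.trans hx.1))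
    refine ⟨ξ, hξ.1.le, hξ.2.le, ?_⟩
    rw [e, add_sub_cancel_left]; field_simp

lemma hasDerivAt_diff {f f' : ℝ → ℝ} (hf : ∀ x > 0, HasDerivAt f (f' x) x) {h : ℝ} (hh : 0 ≤ h) :
    ∀ x > 0, HasDerivAt (fun x => f (x + h) - f x) (f' (x + h) - f' x) x := by
  intro x hx
  exact ((hf (x + h) (by linarith)).comp_add_const x h).sub (hf x hx)

lemma exists_diff_diff_eq {f f₁ f₂ : ℝ → ℝ} (hf : ∀ x > 0, HasDerivAt f (f₁ x) x)
    (h₁ : ∀ x > 0, HasDerivAt f₁ (f₂ x) x) {y h k : ℝ} (hy : 0 < y) (hh : 0 ≤ h) (hk : 0 ≤ k) :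
    ∃ ξ, y ≤ ξ ∧ ξ ≤ y + h + k ∧
      (f (y + k + h) - f (y + k)) - (f (y + h) - f y) = h * k * f₂ ξ := by
  obtain ⟨ξ, h1, h2, e⟩ := exists_diff_eq (hasDerivAt_diff hf hh) hy hk
  obtain ⟨η, h3, h4, e'⟩ := exists_diff_eq h₁ (hy.trans_le h1) hh
  refine ⟨η, by linarith, by linarith, ?_⟩
  rw [e, e']; ring

lemma exists_diff_diff_diff_eq {f f₁ f₂ f₃ : ℝ → ℝ} (hf : ∀ x > 0, HasDerivAt f (f₁ x) x)
    (h₁ : ∀ x > 0, HasDerivAt f₁ (f₂ x) x) (h₂ : ∀ x > 0, HasDerivAt f₂ (f₃ x) x)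
    {y h k l : ℝ} (hy : 0 < y) (hh : 0 ≤ h) (hk : 0 ≤ k) (hl : 0 ≤ l) :
    ∃ ξ, y ≤ ξ ∧ ξ ≤ y + h + k + l ∧
      ((f (y + l + k + h) - f (y + l + k)) - (f (y + l + h) - f (y + l))) -
      ((f (y + k + h) - f (y + k)) - (f (y + h) - f y)) = h * k * l * f₃ ξ := by
  obtain ⟨ξ, h1, h2, e⟩ := exists_diff_diff_eq (hasDerivAt_diff hf hh) (hasDerivAt_diff h₁ hh)
    hy hk hl
  obtain ⟨η, h3, h4, e'⟩ := exists_diff_eq h₂ (hy.trans_le h1) hh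
  refine ⟨η, by linarith, by linarith, ?_⟩
  rw [e, e']; ring

lemma hasDerivAt_one_div : ∀ x > (0 : ℝ), HasDerivAt (fun x : ℝ => 1 / x) (-1 / x ^ 2) x := by
  intro x hx
  simpa [neg_div] using hasDerivAt_inv hx.ne'

lemma hasDerivAt_neg_one_div_sq :
    ∀ x > (0 : ℝ), HasDerivAt (fun x : ℝ => -1 / x ^ 2) (2 / x ^ 3) x := by
  intro x hx
  refine ((hasDerivAt_const x (-1 : ℝ)).div (hasDerivAt_pow 2 x) (by positivity)).congr_deriv ?_
  simp only [Nat.cast_ofNat]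
  field_simp
  ring

lemma hasDerivAt_two_div_cube :
    ∀ x > (0 : ℝ), HasDerivAt (fun x : ℝ => 2 / x ^ 3) (-6 / x ^ 4) x := by
  intro x hx
  refine ((hasDerivAt_const x (2 : ℝ)).div (hasDerivAt_pow 3 x) (by positivity)).congr_deriv ?_
  simp only [Nat.cast_ofNat]
  field_simp
  ring

lemma hasDerivAt_log' : ∀ x > (0 : ℝ), HasDerivAt Real.log (1 / x) x := by
  intro x hx
  simpa using Real.hasDerivAt_log hx.ne'

lemma norm_sum_exp_neg (s : Finset ℕ) (x : ℕ → ℝ) :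
    ‖∑ n ∈ s, exp ((-x n : ℝ) * I)‖ = ‖∑ n ∈ s, exp (x n * I)‖ := by
  rw [← Complex.norm_conj, map_sum]
  congr 1
  refine Finset.sum_congr rfl fun n _ => ?_
  rw [← Complex.exp_conj]; simp

/-- Kusmin–Landau with bounds on the increments. -/
lemma norm_sum_exp_le_of_bounds (x : ℕ → ℝ) (A B : ℕ) {δ : ℝ} (hδ : 0 < δ)
    (hlow : ∀ n ∈ Finset.Icc A B, δ ≤ x (n + 1) - x n)
    (hpi : ∀ n ∈ Finset.Icc A B, x (n + 1) - x n ≤ Real.pi)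
    (hanti : ∀ n ∈ Finset.Ico A B, x (n + 2) - x (n + 1) ≤ x (n + 1) - x n) :
    ‖∑ n ∈ Finset.Ico A B, exp (x n * I)‖ ≤ 16 / δ := by
  rcases le_or_gt A B with h | h
  · refine (norm_sum_exp_le_of_antitone x A B h (fun n hn => hδ.trans_le (hlow n hn)) hpi
      hanti).trans ?_
    have := hlow B (Finset.mem_Icc.2 ⟨h, le_rfl⟩)
    gcongr
  · rw [Finset.Ico_eq_empty (by omega)]; simp; positivity

section
variable {a t : ℝ} {M B : ℕ}

lemma norm_sum_exp_log_le (ha : 0 < a) (ha1 : a ≤ 1) (ht : 0 < t) (hM : 1 ≤ M) (hB : B ≤ 2 * M)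
    (htM : t ≤ M) :
    ‖∑ n ∈ Finset.Ico M B, exp ((t * Real.log (n + a) : ℝ) * I)‖ ≤ 64 * M / t := by
  have hM' : (1 : ℝ) ≤ M := by exact_mod_cast hM
  have key : ∀ n ∈ Finset.Icc M B, ∃ ξ : ℝ, (M : ℝ) ≤ ξ ∧ ξ ≤ 4 * M ∧
      t * Real.log ((n + 1 : ℕ) + a) - t * Real.log (n + a) = t / ξ := by
    intro n hn
    rw [Finset.mem_Icc] at hn
    have h1 : (M : ℝ) ≤ n := by exact_mod_cast hn.1
    have h2 : (n : ℝ) ≤ 2 * M := by exact_mod_cast hn.2.trans hB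
    obtain ⟨ξ, h3, h4, e⟩ := exists_diff_eq hasDerivAt_log' (y := n + a) (h := 1)
      (by positivity) (by norm_num)
    refine ⟨ξ, by linarith, by linarith, ?_⟩
    rw [← mul_sub, Nat.cast_add_one, add_right_comm, e]; ring
  have := norm_sum_exp_le_of_bounds (fun n => t * Real.log (n + a)) M B (δ := t / (4 * M))
    (by positivity) ?_ ?_ ?_
  · refine this.trans (le_of_eq ?_); field_simp; ring
  · intro n hn
    obtain ⟨ξ, h1, h2, e⟩ := key n hn
    have : 0 < ξ := by linarith
    simp only [e]; gcongr
  · intro n hn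
    obtain ⟨ξ, h1, h2, e⟩ := key n hn
    have : 0 < ξ := by linarith
    simp only [e]
    rw [div_le_iff₀ this]
    nlinarith [Real.pi_gt_three]
  · intro n hn
    have hn0 : (0 : ℝ) < n + a := by positivity
    obtain ⟨ξ, h1, h2, e⟩ := exists_diff_diff_eq hasDerivAt_log' hasDerivAt_one_div
      (y := n + a) (h := 1) (k := 1) hn0 (by norm_num) (by norm_num)
    have : 0 < ξ := by linarith
    have h3 : (1 : ℝ) * 1 * (-1 / ξ ^ 2) ≤ 0 := by
      rw [neg_div]; simp; positivity
    rw [← e] at h3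
    push_cast
    rw [show (n : ℝ) + 2 + a = n + a + 1 + 1 by ring, show (n : ℝ) + 1 + a = n + a + 1 by ring]
    nlinarith

lemma norm_sum_exp_diff_log_le (ha : 0 < a) (ha1 : a ≤ 1) (ht : 0 < t) (hM : 1 ≤ M)
    (hB : B ≤ 2 * M) (h : ℕ) (hh : 1 ≤ h) (hhM : t * h ≤ M ^ 2) :
    ‖∑ n ∈ Finset.Ico M (B - h),
      exp ((t * Real.log ((n + h : ℕ) + a) - t * Real.log (n + a) : ℝ) * I)‖
        ≤ 256 * (M ^ 2 / (t * h)) := by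
  have hM' : (1 : ℝ) ≤ M := by exact_mod_cast hM
  have hh' : (1 : ℝ) ≤ h := by exact_mod_cast hh
  rcases le_or_gt (B - h) M with hBh | hBh
  · rw [Finset.Ico_eq_empty (by omega)]; simp; positivity
  set x : ℕ → ℝ := fun n => -(t * Real.log ((n + h : ℕ) + a) - t * Real.log (n + a)) with hx
  have key : ∀ n ∈ Finset.Icc M (B - h), ∃ ξ : ℝ, (M : ℝ) ≤ ξ ∧ ξ ≤ 4 * M ∧
      x (n + 1) - x n = t * h / ξ ^ 2 := by
    intro n hn
    rw [Finset.mem_Icc] at hn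
    have h1 : (M : ℝ) ≤ n := by exact_mod_cast hn.1
    have h2 : (n : ℝ) + h ≤ 2 * M := by exact_mod_cast (by omega : n + h ≤ 2 * M)
    obtain ⟨ξ, h3, h4, e⟩ := exists_diff_diff_eq hasDerivAt_log' hasDerivAt_one_div
      (y := n + a) (h := h) (k := 1) (by positivity) (by positivity) (by norm_num)
    refine ⟨ξ, by linarith, by linarith, ?_⟩
    simp only [hx]; push_cast
    rw [show (n : ℝ) + 1 + h + a = n + a + 1 + h by ring,
      show (n : ℝ) + 1 + a = n + a + 1 by ring, show (n : ℝ) + h + a = n + a + h by ring]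
    linear_combination (-t) * e
  have := norm_sum_exp_le_of_bounds x M (B - h) (δ := t * h / (4 * M) ^ 2)
    (by positivity) ?_ ?_ ?_
  · rw [hx, norm_sum_exp_neg] at this
    refine this.trans (le_of_eq ?_); field_simp; ring
  · intro n hn
    obtain ⟨ξ, h1, h2, e⟩ := key n hn
    have : 0 < ξ := by linarith
    rw [e]; gcongr
  · intro n hn
    obtain ⟨ξ, h1, h2, e⟩ := key n hn
    have : 0 < ξ := by linarith
    rw [e, div_le_iff₀ (by positivity)]
    have : (M : ℝ) ^ 2 ≤ ξ ^ 2 := by gcongr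
    nlinarith [Real.pi_gt_three]
  · intro n hn
    have hn0 : (0 : ℝ) < n + a := by positivity
    obtain ⟨ξ, h1, h2, e⟩ := exists_diff_diff_diff_eq hasDerivAt_log' hasDerivAt_one_div
      hasDerivAt_neg_one_div_sq
      (y := n + a) (h := h) (k := 1) (l := 1) hn0 (by positivity) (by norm_num) (by norm_num)
    have : 0 < ξ := by linarith
    have h3 : 0 ≤ (h : ℝ) * 1 * 1 * (2 / ξ ^ 3) := by positivity
    rw [← e] at h3
    have := mul_nonneg ht.le h3
    simp only [hx]
    push_cast
    rw [show (n : ℝ) + 2 + a = n + a + 1 + 1 by ring, show (n : ℝ) + 1 + a = n + a + 1 by ring,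
      show (n : ℝ) + 2 + h + a = n + a + 1 + 1 + h by ring,
      show (n : ℝ) + 1 + h + a = n + a + 1 + h by ring, show (n : ℝ) + h + a = n + a + h by ring]
    linarith

lemma norm_sum_exp_diff_diff_log_le (ha : 0 < a) (ha1 : a ≤ 1) (ht : 0 < t) (hM : 1 ≤ M)
    (hB : B ≤ 2 * M) (h k : ℕ) (hh : 1 ≤ h) (hk : 1 ≤ k) (hhM : t * (h * k) ≤ M ^ 3) :
    ‖∑ n ∈ Finset.Ico M (B - h - k),
      exp (((t * Real.log ((n + k + h : ℕ) + a) - t * Real.log ((n + k : ℕ) + a)) -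
        (t * Real.log ((n + h : ℕ) + a) - t * Real.log (n + a)) : ℝ) * I)‖
        ≤ 512 * (M ^ 3 / (t * (h * k))) := by
  have hM' : (1 : ℝ) ≤ M := by exact_mod_cast hM
  have hh' : (1 : ℝ) ≤ h := by exact_mod_cast hh
  have hk' : (1 : ℝ) ≤ k := by exact_mod_cast hk
  rcases le_or_gt (B - h - k) M with hBh | hBh
  · rw [Finset.Ico_eq_empty (by omega)]; simp; positivity
  set x : ℕ → ℝ := fun n => (t * Real.log ((n + k + h : ℕ) + a) - t * Real.log ((n + k : ℕ) + a)) -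
        (t * Real.log ((n + h : ℕ) + a) - t * Real.log (n + a)) with hx
  have key : ∀ n ∈ Finset.Icc M (B - h - k), ∃ ξ : ℝ, (M : ℝ) ≤ ξ ∧ ξ ≤ 4 * M ∧
      x (n + 1) - x n = 2 * (t * (h * k)) / ξ ^ 3 := by
    intro n hn
    rw [Finset.mem_Icc] at hn
    have h1 : (M : ℝ) ≤ n := by exact_mod_cast hn.1
    have h2 : (n : ℝ) + h + k ≤ 2 * M := by exact_mod_cast (by omega : n + h + k ≤ 2 * M)
    obtain ⟨ξ, h3, h4, e⟩ := exists_diff_diff_diff_eq hasDerivAt_log' hasDerivAt_one_div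
      hasDerivAt_neg_one_div_sq
      (y := n + a) (h := h) (k := k) (l := 1) (by positivity) (by positivity) (by positivity)
      (by norm_num)
    refine ⟨ξ, by linarith, by linarith, ?_⟩
    simp only [hx]; push_cast
    rw [show (n : ℝ) + 1 + k + h + a = n + a + 1 + k + h by ring,
      show (n : ℝ) + 1 + k + a = n + a + 1 + k by ring,
      show (n : ℝ) + 1 + h + a = n + a + 1 + h by ring,
      show (n : ℝ) + 1 + a = n + a + 1 by ring, show (n : ℝ) + h + a = n + a + h by ring,
      show (n : ℝ) + k + h + a = n + a + k + h by ring, show (n : ℝ) + k + a = n + a + k by ring]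
    linear_combination t * e
  have := norm_sum_exp_le_of_bounds x M (B - h - k) (δ := 2 * (t * (h * k)) / (4 * M) ^ 3)
    (by positivity) ?_ ?_ ?_
  · refine this.trans (le_of_eq ?_); field_simp; ring
  · intro n hn
    obtain ⟨ξ, h1, h2, e⟩ := key n hn
    have : 0 < ξ := by linarith
    rw [e]; gcongr
  · intro n hn
    obtain ⟨ξ, h1, h2, e⟩ := key n hn
    have : 0 < ξ := by linarith
    rw [e, div_le_iff₀ (by positivity)]
    have : (M : ℝ) ^ 3 ≤ ξ ^ 3 := by gcongr
    have h4 := mul_le_mul_of_nonneg_right Real.pi_gt_three.le (by positivity : 0 ≤ ξ ^ 3)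
    have : 0 < ξ ^ 3 := by positivity
    linarith
  · intro n hn
    have hn0 : (0 : ℝ) < n + a := by positivity
    have d1 := hasDerivAt_diff hasDerivAt_log' (h := h) (by positivity)
    have d2 := hasDerivAt_diff hasDerivAt_one_div (h := h) (by positivity)
    have d3 := hasDerivAt_diff hasDerivAt_neg_one_div_sq (h := h) (by positivity)
    obtain ⟨ξ, h1, h2, e⟩ := exists_diff_diff_diff_eq d1 d2 d3
      (y := n + a) (h := k) (k := 1) (l := 1) hn0 (by positivity) (by norm_num) (by norm_num)
    have : 0 < ξ := by linarith
    obtain ⟨η, h3, h4, e'⟩ := exists_diff_eq hasDerivAt_two_div_cube this (h := h) (by positivity)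
    rw [e'] at e
    have hη : 0 < η := by linarith
    have h3 : (k : ℝ) * 1 * 1 * (h * (-6 / η ^ 4)) ≤ 0 := by
      have : 0 ≤ (k : ℝ) * h * (6 / η ^ 4) := by positivity
      rw [neg_div]; linarith
    rw [← e] at h3
    have := mul_nonneg ht.le (neg_nonneg.2 h3)
    simp only [hx]
    push_cast
    rw [show (n : ℝ) + 2 + k + h + a = n + a + 1 + 1 + k + h by ring,
      show (n : ℝ) + 2 + k + a = n + a + 1 + 1 + k by ring,
      show (n : ℝ) + 2 + h + a = n + a + 1 + 1 + h by ring,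
      show (n : ℝ) + 2 + a = n + a + 1 + 1 by ring,
      show (n : ℝ) + 1 + k + h + a = n + a + 1 + k + h by ring,
      show (n : ℝ) + 1 + k + a = n + a + 1 + k by ring,
      show (n : ℝ) + 1 + h + a = n + a + 1 + h by ring,
      show (n : ℝ) + 1 + a = n + a + 1 by ring, show (n : ℝ) + h + a = n + a + h by ring,
      show (n : ℝ) + k + h + a = n + a + k + h by ring, show (n : ℝ) + k + a = n + a + k by ring]
    linarith

end

lemma sum_Ico_one_div_le {H : ℕ} {Y : ℝ} (hY : 1 ≤ Y) (hH : H ≤ Y + 1) :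
    ∑ h ∈ Finset.Ico 1 H, (1 : ℝ) / h ≤ 1 + Real.log Y := by
  rcases Nat.lt_or_ge H 2 with h | h
  · rw [Finset.Ico_eq_empty (by omega)]
    have := Real.log_nonneg hY
    simp; linarith
  obtain ⟨n, rfl⟩ : ∃ n, H = n + 1 := ⟨H - 1, by omega⟩
  have h1 := harmonic_le_one_add_log n
  rw [harmonic_eq_sum_Icc] at h1
  push_cast at h1 hH
  rw [show Finset.Ico 1 (n + 1) = Finset.Icc 1 n by ext; simp]
  have h3 : (1 : ℝ) ≤ n := by exact_mod_cast (by omega : 1 ≤ n)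
  have h2 : Real.log n ≤ Real.log Y := Real.log_le_log (by linarith) (by linarith)
  simp only [one_div]
  linarith

section
variable {a t : ℝ} {M B : ℕ}

lemma norm_sum_exp_le_card (x : ℕ → ℝ) (s : Finset ℕ) :
    ‖∑ n ∈ s, exp (x n * I)‖ ≤ s.card := by
  refine (norm_sum_le _ _).trans (le_of_eq ?_)
  simp [norm_exp_ofReal_mul_I]

/-- The Weyl–van der Corput inequality with a real shift parameter `y`. -/
lemma sq_norm_sum_exp_le_of_le (x : ℕ → ℝ) (hM : 1 ≤ M) (hB : B ≤ 2 * M) {y : ℝ} (hy : 1 ≤ y)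
    (hyM : y ≤ M) :
    ‖∑ n ∈ Finset.Ico M B, exp (x n * I)‖ ^ 2 ≤
      (3 * M / y) * (M + 2 * ∑ h ∈ Finset.Ico 1 (⌊y⌋₊ + 1),
        ‖∑ n ∈ Finset.Ico M (B - h), exp ((x (n + h) - x n : ℝ) * I)‖) := by
  have hM' : (1 : ℝ) ≤ M := by exact_mod_cast hM
  rcases le_or_gt B M with h | h
  · rw [Finset.Ico_eq_empty (by omega)]
    have : 0 < y := by linarith
    rw [Finset.sum_empty, norm_zero, zero_pow two_ne_zero]
    positivity
  refine (sq_norm_sum_exp_le x M B h.le (⌊y⌋₊ + 1) (by omega)).trans ?_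
  have h1 : ((B - M : ℕ) : ℝ) ≤ M := by exact_mod_cast (by omega)
  have h2 := Nat.floor_le (by linarith : 0 ≤ y)
  have h3 := (Nat.lt_floor_add_one y).le
  gcongr
  · push_cast
    linarith
  · push_cast
    exact h3

lemma sq_norm_sum_exp_log_le (ha : 0 < a) (ha1 : a ≤ 1) (ht : 1 ≤ t) (hM : 1 ≤ M)
    (hB : B ≤ 2 * M) (hMt : M ≤ t) (htM : t ≤ M ^ 2) :
    ‖∑ n ∈ Finset.Ico M B, exp ((t * Real.log (n + a) : ℝ) * I)‖ ^ 2
      ≤ 1539 * (1 + Real.log t) * t := by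
  have hM' : (1 : ℝ) ≤ M := by exact_mod_cast hM
  have hy : 1 ≤ (M : ℝ) ^ 2 / t := by rw [le_div_iff₀ (by linarith)]; linarith
  have hyM : (M : ℝ) ^ 2 / t ≤ M := by rw [div_le_iff₀ (by linarith)]; nlinarith
  have hlog := Real.log_nonneg ht
  refine (sq_norm_sum_exp_le_of_le (fun n => t * Real.log (n + a)) hM hB hy hyM).trans ?_
  set y := (M : ℝ) ^ 2 / t with hyd
  have hfl := Nat.floor_le (by linarith : 0 ≤ y)
  have hs : ∑ h ∈ Finset.Ico 1 (⌊y⌋₊ + 1),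
        ‖∑ n ∈ Finset.Ico M (B - h),
          exp ((t * Real.log ((n + h : ℕ) + a) - t * Real.log (n + a) : ℝ) * I)‖
        ≤ 256 * y * (1 + Real.log t) := by
    calc _ ≤ ∑ h ∈ Finset.Ico 1 (⌊y⌋₊ + 1), 256 * y * (1 / (h : ℝ)) := by
          refine Finset.sum_le_sum fun h hh => ?_
          rw [Finset.mem_Ico] at hh
          have h1 : (h : ℝ) ≤ y := le_trans (by exact_mod_cast (by omega : h ≤ ⌊y⌋₊)) hfl
          refine (norm_sum_exp_diff_log_le ha ha1 (by linarith) hM hB h hh.1 ?_).trans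
            (le_of_eq ?_)
          · rw [hyd, le_div_iff₀ (by linarith)] at h1; linarith
          · rw [hyd]
            have : (h : ℝ) ≠ 0 := by exact_mod_cast (by omega)
            field_simp
      _ ≤ _ := by
          rw [← Finset.mul_sum]
          gcongr
          exact sum_Ico_one_div_le ht (by push_cast; linarith)
  calc _ ≤ (3 * M / y) * (M + 2 * (256 * y * (1 + Real.log t))) := by gcongr
    _ ≤ (3 * M / y) * (M * (1 + Real.log t) + 2 * (256 * M * (1 + Real.log t))) := by
        gcongr
        nlinarith
    _ = _ := by rw [hyd]; field_simp; ring

lemma sq_norm_sum_exp_log_le' (ha : 0 < a) (ha1 : a ≤ 1) (ht : 1 ≤ t) (hM : 1 ≤ M)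
    (hB : B ≤ 2 * M) (hMt : M ≤ t) {w : ℝ} (hw : 1 ≤ w) (hwM : w ^ 4 * t = M ^ 3) :
    ‖∑ n ∈ Finset.Ico M B, exp ((t * Real.log (n + a) : ℝ) * I)‖ ^ 2
      ≤ 477 * (1 + Real.log t) * (M ^ 2 / w) := by
  have hM' : (1 : ℝ) ≤ M := by exact_mod_cast hM
  set y := w ^ 2 with hyd
  set ℓ := 1 + Real.log t with hℓ
  have hlog : 1 ≤ ℓ := by have := Real.log_nonneg ht; linarith
  have hy : 1 ≤ y := one_le_pow₀ hw
  have hyM : y ≤ M := by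
    refine le_of_sq_le_sq ?_ (by linarith)
    have : y ^ 2 * t = M ^ 2 * M := by rw [hyd]; linear_combination hwM
    have h2 : (M : ℝ) ^ 2 * M ≤ M ^ 2 * t := by gcongr
    exact le_of_mul_le_mul_right (this.trans_le h2) (by linarith)
  have hfl := Nat.floor_le (by linarith : 0 ≤ y)
  set x : ℕ → ℝ := fun n => t * Real.log (n + a) with hx
  refine (sq_norm_sum_exp_le_of_le x hM hB hy hyM).trans ?_
  set T : ℕ → ℝ := fun h => ‖∑ n ∈ Finset.Ico M (B - h), exp ((x (n + h) - x n : ℝ) * I)‖ with hT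
  have hinner : ∀ h ∈ Finset.Ico 1 (⌊y⌋₊ + 1),
      T h ^ 2 ≤ (3 * M / y) * (M + 1024 * y ^ 2 * ℓ * (1 / h)) := by
    intro h hh
    rw [Finset.mem_Ico] at hh
    have hh0 : (1 : ℝ) ≤ h := by exact_mod_cast hh.1
    have h1 : (h : ℝ) ≤ y := le_trans (by exact_mod_cast (by omega : h ≤ ⌊y⌋₊)) hfl
    refine (sq_norm_sum_exp_le_of_le (fun n => x (n + h) - x n) hM
      (by omega : B - h ≤ 2 * M) hy hyM).trans ?_
    have hs : ∑ k ∈ Finset.Ico 1 (⌊y⌋₊ + 1), ‖∑ n ∈ Finset.Ico M (B - h - k),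
        exp (((x (n + k + h) - x (n + k)) - (x (n + h) - x n) : ℝ) * I)‖
        ≤ 512 * (y ^ 2 / h) * ℓ := by
      calc _ ≤ ∑ k ∈ Finset.Ico 1 (⌊y⌋₊ + 1), 512 * (y ^ 2 / h) * (1 / (k : ℝ)) := by
            refine Finset.sum_le_sum fun k hk => ?_
            rw [Finset.mem_Ico] at hk
            have hk0 : (1 : ℝ) ≤ k := by exact_mod_cast hk.1
            have h2 : (k : ℝ) ≤ y := le_trans (by exact_mod_cast (by omega : k ≤ ⌊y⌋₊)) hfl
            refine (norm_sum_exp_diff_diff_log_le ha ha1 (by linarith) hM hB h k hh.1 hk.1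
              ?_).trans (le_of_eq ?_)
            · calc t * (h * k) ≤ t * (y * y) := by gcongr
                _ = M ^ 3 := by rw [hyd]; linear_combination hwM
            · rw [← hwM, hyd]
              field_simp
        _ ≤ _ := by
            rw [← Finset.mul_sum]
            gcongr
            exact sum_Ico_one_div_le ht (by push_cast; linarith)
    calc _ ≤ (3 * M / y) * (M + 2 * (512 * (y ^ 2 / h) * ℓ)) := by gcongr
      _ = _ := by ring
  have hsumsq : ∑ h ∈ Finset.Ico 1 (⌊y⌋₊ + 1), T h ^ 2 ≤ 3078 * M ^ 2 * ℓ ^ 2 := by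
    refine (Finset.sum_le_sum hinner).trans ?_
    rw [← Finset.mul_sum, Finset.sum_add_distrib, ← Finset.mul_sum]
    have h1 : ∑ h ∈ Finset.Ico 1 (⌊y⌋₊ + 1), (1 : ℝ) / h ≤ ℓ :=
      sum_Ico_one_div_le ht (by push_cast; linarith)
    have h2 : ∑ h ∈ Finset.Ico 1 (⌊y⌋₊ + 1), (M : ℝ) ≤ y * M := by
      simp; gcongr
    calc _ ≤ (3 * M / y) * (y * M + 1024 * y ^ 2 * ℓ * ℓ) := by gcongr
      _ = 3 * M * (M + 1024 * y * ℓ ^ 2) := by field_simp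
      _ ≤ 3 * M * (M * ℓ ^ 2 + 1024 * M * ℓ ^ 2) := by
          gcongr
          have : 1 ≤ ℓ ^ 2 := one_le_pow₀ hlog
          nlinarith
      _ ≤ _ := by nlinarith [sq_nonneg (M * ℓ)]
  have hsum : ∑ h ∈ Finset.Ico 1 (⌊y⌋₊ + 1), T h ≤ 79 * w * M * ℓ := by
    refine le_of_sq_le_sq ?_ (by positivity)
    calc _ ≤ ((Finset.Ico 1 (⌊y⌋₊ + 1)).card : ℝ) * ∑ h ∈ Finset.Ico 1 (⌊y⌋₊ + 1), T h ^ 2 :=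
          sq_sum_le_card_mul_sum_sq
      _ ≤ y * (3078 * M ^ 2 * ℓ ^ 2) := by
          gcongr
          simpa using hfl
      _ ≤ _ := by rw [hyd]; nlinarith [sq_nonneg (w * M * ℓ)]
  calc _ ≤ (3 * M / y) * (M + 2 * (79 * w * M * ℓ)) := by gcongr
    _ ≤ (3 * M / y) * (w * M * ℓ + 2 * (79 * w * M * ℓ)) := by
        gcongr
        have : 1 ≤ w * ℓ := one_le_mul_of_one_le_of_one_le hw hlog
        nlinarith
    _ = _ := by rw [hyd]; field_simp; ring

end

section
variable {a t : ℝ} {M B : ℕ}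

lemma norm_sum_exp_log_le_rpow (ha : 0 < a) (ha1 : a ≤ 1) (ht : 1 ≤ t) (hM : 1 ≤ M)
    (hB : B ≤ 2 * M) (hMt : M ≤ 4 * t ^ 2) :
    ‖∑ n ∈ Finset.Ico M B, exp ((t * Real.log (n + a) : ℝ) * I)‖
      ≤ 200 * (1 + Real.log t) * ((M : ℝ) ^ (1 / 2 : ℝ) * t ^ (5 / 24 : ℝ)) := by
  have hM' : (1 : ℝ) ≤ M := by exact_mod_cast hM
  set ℓ := 1 + Real.log t with hℓ
  have hlog : 1 ≤ ℓ := by have := Real.log_nonneg ht; linarith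
  have hu : 1 ≤ t ^ (5 / 24 : ℝ) := Real.one_le_rpow ht (by norm_num)
  have hsqM : ((M : ℝ) ^ (1 / 2 : ℝ)) ^ 2 = M := by
    rw [← Real.rpow_natCast, ← Real.rpow_mul (by linarith)]; norm_num
  have hsqM0 : 0 < (M : ℝ) ^ (1 / 2 : ℝ) := by positivity
  have ht5 : (t ^ (5 / 24 : ℝ)) ^ 2 = t ^ (5 / 12 : ℝ) := by
    rw [← Real.rpow_natCast, ← Real.rpow_mul (by linarith)]; norm_num
  have ht0 : 0 < t := by linarith
  rcases le_total t M with h | h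
  · refine (norm_sum_exp_log_le ha ha1 (by linarith) hM hB h).trans ?_
    have h1 : (M : ℝ) ^ (1 / 2 : ℝ) ≤ 2 * t := by
      refine le_of_sq_le_sq ?_ (by linarith)
      rw [hsqM]; linarith
    calc 64 * (M : ℝ) / t = 64 * ((M : ℝ) ^ (1 / 2 : ℝ) * (M : ℝ) ^ (1 / 2 : ℝ)) / t := by
          rw [← sq, hsqM]
      _ ≤ 64 * ((M : ℝ) ^ (1 / 2 : ℝ) * (2 * t)) / t := by gcongr
      _ = 128 * 1 * ((M : ℝ) ^ (1 / 2 : ℝ) * 1) := by field_simp; norm_num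
      _ ≤ _ := by gcongr; norm_num
  rcases le_total (t ^ 2) ((M : ℝ) ^ 3) with h2 | h2
  · refine le_of_sq_le_sq ?_ (by positivity)
    have htM : t ≤ M ^ 2 := by
      have : t * t ≤ t * M ^ 2 := by nlinarith
      exact le_of_mul_le_mul_left this ht0
    refine (sq_norm_sum_exp_log_le ha ha1 ht hM hB h htM).trans ?_
    have h3 : t ^ (2 / 3 : ℝ) ≤ M := by
      refine le_of_pow_le_pow_left₀ (n := 3) (by norm_num) (by linarith) ?_
      rw [← Real.rpow_natCast (t ^ (2 / 3 : ℝ)), ← Real.rpow_mul (by linarith)]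
      norm_num [h2]
    have h4 : t ≤ M * t ^ (5 / 12 : ℝ) := by
      calc t = t ^ (7 / 12 : ℝ) * t ^ (5 / 12 : ℝ) := by
            rw [← Real.rpow_add ht0]; norm_num
        _ ≤ t ^ (2 / 3 : ℝ) * t ^ (5 / 12 : ℝ) := by
            exact mul_le_mul_of_nonneg_right
              (Real.rpow_le_rpow_of_exponent_le ht (by norm_num)) (by positivity)
        _ ≤ _ := by gcongr
    calc 1539 * ℓ * t ≤ 40000 * (ℓ * ℓ) * (M * t ^ (5 / 12 : ℝ)) := by
          gcongr
          · norm_num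
          · nlinarith
      _ = _ := by rw [← ht5]; nth_rewrite 1 [← hsqM]; ring
  rcases le_total t ((M : ℝ) ^ 3) with h3 | h3
  · refine le_of_sq_le_sq ?_ (by positivity)
    set w : ℝ := (M ^ 3 / t) ^ (1 / 4 : ℝ) with hw
    have hq : 1 ≤ (M : ℝ) ^ 3 / t := by rwa [le_div_iff₀ ht0, one_mul]
    have hw1 : 1 ≤ w := Real.one_le_rpow hq (by norm_num)
    have hw4 : w ^ 4 * t = M ^ 3 := by
      rw [hw, ← Real.rpow_natCast, ← Real.rpow_mul (by linarith)]
      norm_num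
      field_simp
    refine (sq_norm_sum_exp_log_le' ha ha1 ht hM hB h hw1 hw4).trans ?_
    have h5 : (M : ℝ) ≤ t ^ (2 / 3 : ℝ) := by
      refine le_of_pow_le_pow_left₀ (n := 3) (by norm_num) (by positivity) ?_
      rw [← Real.rpow_natCast (t ^ (2 / 3 : ℝ)), ← Real.rpow_mul (by linarith)]
      norm_num [h2]
    have h6 : (M : ℝ) ≤ w * t ^ (5 / 12 : ℝ) := by
      refine le_of_pow_le_pow_left₀ (n := 4) (by norm_num) (by positivity) ?_
      rw [mul_pow, ← Real.rpow_natCast (t ^ (5 / 12 : ℝ)), ← Real.rpow_mul (by linarith)]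
      calc (M : ℝ) ^ 4 = M ^ 3 * M := by ring
        _ ≤ w ^ 4 * t * t ^ (2 / 3 : ℝ) := by rw [hw4]; gcongr
        _ = _ := by
          rw [mul_assoc]; congr 1
          nth_rewrite 1 [← Real.rpow_one t]
          rw [← Real.rpow_add ht0]; norm_num
    calc 477 * ℓ * (M ^ 2 / w) ≤ 40000 * (ℓ * ℓ) * (M * t ^ (5 / 12 : ℝ)) := by
          gcongr
          · norm_num
          · nlinarith
          · rw [div_le_iff₀ (by linarith)]; nlinarith
      _ = _ := by rw [← ht5]; nth_rewrite 1 [← hsqM]; ring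
  · refine (norm_sum_exp_le_card _ _).trans ?_
    have h5 : (M : ℝ) ≤ (t ^ (5 / 24 : ℝ)) ^ 2 := by
      rw [ht5]
      refine le_of_pow_le_pow_left₀ (n := 3) (by norm_num) (by positivity) ?_
      rw [← Real.rpow_natCast (t ^ (5 / 12 : ℝ)), ← Real.rpow_mul (by linarith)]
      refine h3.trans ?_
      nth_rewrite 1 [← Real.rpow_one t]
      exact Real.rpow_le_rpow_of_exponent_le ht (by norm_num)
    have h6 : (M : ℝ) ^ (1 / 2 : ℝ) ≤ t ^ (5 / 24 : ℝ) := by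
      refine le_of_sq_le_sq ?_ (by positivity)
      rwa [hsqM]
    calc ((Finset.Ico M B).card : ℝ) ≤ M := by
          rw [Nat.card_Ico]; exact_mod_cast (by omega)
      _ = 1 * 1 * ((M : ℝ) ^ (1 / 2 : ℝ) * (M : ℝ) ^ (1 / 2 : ℝ)) := by rw [one_mul, one_mul, ← sq, hsqM]
      _ ≤ _ := by gcongr; norm_num

lemma norm_sum_exp_neg_log_le_rpow (ha : 0 < a) (ha1 : a ≤ 1) (ht : 1 ≤ |t|) (hM : 1 ≤ M)
    (hB : B ≤ 2 * M) (hMt : M ≤ 4 * |t| ^ 2) :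
    ‖∑ n ∈ Finset.Ico M B, exp ((-(t * Real.log (n + a)) : ℝ) * I)‖
      ≤ 200 * (1 + Real.log |t|) * ((M : ℝ) ^ (1 / 2 : ℝ) * |t| ^ (5 / 24 : ℝ)) := by
  have := norm_sum_exp_log_le_rpow ha ha1 ht hM hB hMt
  rcases abs_cases t with ⟨h, _⟩ | ⟨h, _⟩
  · rw [h] at this ⊢
    rwa [norm_sum_exp_neg]
  · rw [h] at this ⊢
    simpa only [neg_mul] using this

/-- Abel's inequality for antitone nonnegative weights. -/
lemma norm_sum_mul_le_of_antitone (w : ℕ → ℝ) (hw : Antitone w) (hw0 : ∀ n, 0 ≤ w n) (z : ℕ → ℂ)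
    (A B : ℕ) (hAB : A ≤ B) {D : ℝ}
    (hD : ∀ b, b ≤ B → ‖∑ n ∈ Finset.Ico A b, z n‖ ≤ D) :
    ‖∑ n ∈ Finset.Ico A B, (w n : ℂ) * z n‖ ≤ w A * D := by
  have key : ∀ b, A ≤ b → b ≤ B →
      ‖∑ n ∈ Finset.Ico A b, (w n : ℂ) * z n - w b * ∑ n ∈ Finset.Ico A b, z n‖
        ≤ (w A - w b) * D := by
    intro b hb
    induction b, hb using Nat.le_induction with
    | base => simp
    | succ b hb ih =>
      intro hbB
      have ih := ih (by omega)
      have h1 := hD (b + 1) hbB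
      have e : ∑ n ∈ Finset.Ico A (b + 1), (w n : ℂ) * z n
          - w (b + 1) * ∑ n ∈ Finset.Ico A (b + 1), z n =
          (∑ n ∈ Finset.Ico A b, (w n : ℂ) * z n - w b * ∑ n ∈ Finset.Ico A b, z n) +
          ((w b - w (b + 1) : ℝ) : ℂ) * ∑ n ∈ Finset.Ico A (b + 1), z n := by
        rw [Finset.sum_Ico_succ_top hb, Finset.sum_Ico_succ_top hb]
        push_cast; ring
      rw [e]
      refine (norm_add_le _ _).trans ?_
      have h2 : 0 ≤ w b - w (b + 1) := sub_nonneg.2 (hw (Nat.le_succ b))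
      rw [norm_mul, Complex.norm_real, Real.norm_of_nonneg h2]
      nlinarith [mul_le_mul_of_nonneg_left h1 h2]
  have h1 := key B hAB le_rfl
  have h2 := hD B le_rfl
  have e : ∑ n ∈ Finset.Ico A B, (w n : ℂ) * z n =
      (∑ n ∈ Finset.Ico A B, (w n : ℂ) * z n - w B * ∑ n ∈ Finset.Ico A B, z n) +
      w B * ∑ n ∈ Finset.Ico A B, z n := by ring
  rw [e]
  refine (norm_add_le _ _).trans ?_
  rw [norm_mul, Complex.norm_real, Real.norm_of_nonneg (hw0 B)]
  nlinarith [mul_le_mul_of_nonneg_left h2 (hw0 B)]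

lemma antitone_add_rpow_neg (ha : 0 < a) {σ : ℝ} (hσ : 0 ≤ σ) :
    Antitone fun n : ℕ => ((n : ℝ) + a) ^ (-σ) := by
  intro m n hmn
  have : (m : ℝ) ≤ n := by exact_mod_cast hmn
  exact Real.rpow_le_rpow_of_nonpos (by positivity) (by linarith) (by linarith)

lemma norm_dyadic_sum_le (ha : 0 < a) (ha1 : a ≤ 1) (ht : 1 ≤ |t|) (hM : 1 ≤ M)
    (hMt : M ≤ 4 * |t| ^ 2) {σ : ℝ} (hσ : 1 / 2 ≤ σ) :
    ‖∑ n ∈ Finset.Ico M (2 * M), (((n + a : ℝ) ^ (-σ) : ℝ) : ℂ) *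
        exp ((-(t * Real.log (n + a)) : ℝ) * I)‖
      ≤ 200 * (1 + Real.log |t|) * |t| ^ (5 / 12 * max (1 - σ) 0) := by
  have hM' : (1 : ℝ) ≤ M := by exact_mod_cast hM
  have hM0 : (0 : ℝ) < M := by linarith
  have hlog : 1 ≤ 1 + Real.log |t| := by have := Real.log_nonneg ht; linarith
  have ht0 : 0 < |t| := by linarith
  have hwM : ((M : ℝ) + a) ^ (-σ) ≤ (M : ℝ) ^ (-σ) :=
    Real.rpow_le_rpow_of_nonpos hM0 (by linarith) (by linarith)
  have hmono : |t| ^ (5 / 12 * (1 - σ)) ≤ |t| ^ (5 / 12 * max (1 - σ) 0) :=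
    Real.rpow_le_rpow_of_exponent_le ht (by gcongr; exact le_max_left _ _)
  have main : ∀ D : ℝ, (∀ b, b ≤ 2 * M →
      ‖∑ n ∈ Finset.Ico M b, exp ((-(t * Real.log (n + a)) : ℝ) * I)‖ ≤ D) →
      ‖∑ n ∈ Finset.Ico M (2 * M), (((n + a : ℝ) ^ (-σ) : ℝ) : ℂ) *
        exp ((-(t * Real.log (n + a)) : ℝ) * I)‖ ≤ (M : ℝ) ^ (-σ) * D := by
    intro D hD
    have hD0 : 0 ≤ D := (norm_nonneg _).trans (hD M (by omega))
    refine (norm_sum_mul_le_of_antitone _ (antitone_add_rpow_neg ha (by linarith))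
      (fun n => by positivity) _ M (2 * M) (by omega) hD).trans ?_
    gcongr
  rcases le_total (M : ℝ) (|t| ^ (5 / 12 : ℝ)) with h | h
  · refine (main M fun b hb => (norm_sum_exp_le_card _ _).trans ?_).trans ?_
    · rw [Nat.card_Ico]; exact_mod_cast (by omega)
    · have h1 : (M : ℝ) ^ (-σ) * M = (M : ℝ) ^ (1 - σ) := by
        rw [sub_eq_neg_add, Real.rpow_add_one hM0.ne']
      rw [h1]
      calc (M : ℝ) ^ (1 - σ) ≤ (M : ℝ) ^ (max (1 - σ) 0) :=
            Real.rpow_le_rpow_of_exponent_le hM' (le_max_left _ _)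
        _ ≤ (|t| ^ (5 / 12 : ℝ)) ^ (max (1 - σ) 0) :=
            Real.rpow_le_rpow hM0.le h (le_max_right _ _)
        _ = 1 * 1 * |t| ^ (5 / 12 * max (1 - σ) 0) := by rw [← Real.rpow_mul ht0.le]; ring
        _ ≤ _ := by gcongr; norm_num
  · refine (main _ fun b hb => norm_sum_exp_neg_log_le_rpow ha ha1 ht hM hb hMt).trans ?_
    have h1 : (M : ℝ) ^ (-σ) * (M : ℝ) ^ (1 / 2 : ℝ) ≤ |t| ^ (5 / 12 * (1 / 2 - σ)) := by
      rw [← Real.rpow_add hM0, Real.rpow_mul ht0.le, ← sub_eq_neg_add]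
      exact Real.rpow_le_rpow_of_nonpos (by positivity) h (by linarith)
    calc _ = 200 * (1 + Real.log |t|) *
          ((M : ℝ) ^ (-σ) * (M : ℝ) ^ (1 / 2 : ℝ) * |t| ^ (5 / 24 : ℝ)) := by ring
      _ ≤ 200 * (1 + Real.log |t|) * (|t| ^ (5 / 12 * (1 / 2 - σ)) * |t| ^ (5 / 24 : ℝ)) := by
          gcongr
      _ = 200 * (1 + Real.log |t|) * |t| ^ (5 / 12 * (1 - σ)) := by
          rw [← Real.rpow_add ht0]; congr 2; ring
      _ ≤ _ := by gcongr

end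

lemma eq_of_eq_of_one_lt_re {f g : ℂ → ℂ}
    (hf : ∀ s : ℂ, 0 < s.re → s.im ≠ 0 → DifferentiableAt ℂ f s)
    (hg : ∀ s : ℂ, 0 < s.re → s.im ≠ 0 → DifferentiableAt ℂ g s)
    (h : ∀ s : ℂ, 1 < s.re → f s = g s) {s : ℂ} (hs : 0 < s.re) (hi : s.im ≠ 0) :
    f s = g s := by
  have key : ∀ U : Set ℂ, IsOpen U → Convex ℝ U → (∀ z ∈ U, 0 < z.re ∧ z.im ≠ 0) →
      ∀ z₀ ∈ U, 1 < z₀.re → Set.EqOn f g U := by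
    intro U hU hc hUs z₀ hz₀ hz1
    refine AnalyticOnNhd.eqOn_of_preconnected_of_eventuallyEq (𝕜 := ℂ)
      (DifferentiableOn.analyticOnNhd (fun z hz =>
        (hf z (hUs z hz).1 (hUs z hz).2).differentiableWithinAt) hU)
      (DifferentiableOn.analyticOnNhd (fun z hz =>
        (hg z (hUs z hz).1 (hUs z hz).2).differentiableWithinAt) hU)
      hc.isPreconnected hz₀ ?_
    have : {z : ℂ | 1 < z.re} ∈ nhds z₀ :=
      (isOpen_lt continuous_const Complex.continuous_re).mem_nhds hz1
    filter_upwards [this] with z hz using h z hz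
  rcases lt_or_gt_of_ne hi with hi' | hi'
  · refine key ({z | 0 < z.re} ∩ {z | z.im < 0}) ?_ ?_ ?_ (2 - I) ?_ ?_ ⟨hs, hi'⟩
    · exact (isOpen_lt continuous_const Complex.continuous_re).inter
        (isOpen_lt Complex.continuous_im continuous_const)
    · exact (convex_halfSpace_re_gt 0).inter (convex_halfSpace_im_lt 0)
    · exact fun z hz => ⟨hz.1, ne_of_lt hz.2⟩
    · simp
    · simp
  · refine key ({z | 0 < z.re} ∩ {z | 0 < z.im}) ?_ ?_ ?_ (2 + I) ?_ ?_ ⟨hs, hi'⟩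
    · exact (isOpen_lt continuous_const Complex.continuous_re).inter
        (isOpen_lt continuous_const Complex.continuous_im)
    · exact (convex_halfSpace_re_gt 0).inter (convex_halfSpace_im_gt 0)
    · exact fun z hz => ⟨hz.1, ne_of_gt hz.2⟩
    · simp
    · simp

/-- The difference between `(n + a)⁻ˢ` and the integral of `x⁻ˢ` over `[n + a, n + 1 + a]`. -/
noncomputable def hurwitzRemainder (a : ℝ) (n : ℕ) (s : ℂ) : ℂ :=
  ((n + a : ℝ) : ℂ) ^ (-s) -
    (((n + a : ℝ) : ℂ) ^ (1 - s) - ((n + 1 + a : ℝ) : ℂ) ^ (1 - s)) / (s - 1)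

section
variable {a : ℝ}

lemma norm_hurwitzRemainder_le (ha : 0 < a) (n : ℕ) {s : ℂ} (hs : 0 < s.re) (hs1 : s ≠ 1) :
    ‖hurwitzRemainder a n s‖ ≤ ‖s‖ * ((n + a : ℝ) ^ (-s.re - 1)) := by
  set y : ℝ := n + a with hy
  have hy0 : 0 < y := by positivity
  have hs0 : s ≠ 0 := by rintro rfl; simp at hs
  have hpos : ∀ u ∈ Set.Icc (0 : ℝ) 1, 0 < y + u := fun u hu => by have := hu.1; linarith
  set C := ‖s‖ * y ^ (-s.re - 1) with hC
  have hC0 : 0 ≤ C := by positivity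
  have hder : ∀ u ∈ Set.Icc (0 : ℝ) 1, ‖(y : ℂ) ^ (-s) - ((y + u : ℝ) : ℂ) ^ (-s)‖ ≤ C := by
    intro u hu
    have hd : ∀ v ∈ Set.Icc (0 : ℝ) 1, HasDerivWithinAt
        (fun v : ℝ => ((y + v : ℝ) : ℂ) ^ (-s)) (-s * ((y + v : ℝ) : ℂ) ^ (-s - 1))
        (Set.Icc 0 1) v := by
      intro v hv
      have h1 := hasDerivAt_ofReal_cpow_const' (hpos v hv).ne' (r := -s - 1)
        (by intro h; apply hs0; linear_combination -h)
      have h2 := ((h1.comp_const_add y v).const_mul (-s)).hasDerivWithinAt (s := Set.Icc 0 1)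
      refine h2.congr_of_mem (fun w hw => ?_) hv
      simp only [sub_add_cancel]
      field_simp
    have := Convex.norm_image_sub_le_of_norm_hasDerivWithin_le hd (C := C) ?_ (convex_Icc 0 1)
      (x := 0) (y := u) (by simp) hu
    · rw [norm_sub_rev]
      simp only [add_zero, sub_zero] at this
      refine this.trans ?_
      rw [Real.norm_of_nonneg hu.1]
      exact mul_le_of_le_one_right hC0 hu.2
    · intro v hv
      rw [norm_mul, norm_neg, norm_cpow_eq_rpow_re_of_pos (hpos v hv)]
      simp only [sub_re, neg_re, one_re]
      rw [hC]
      gcongr ‖s‖ * ?_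
      exact Real.rpow_le_rpow_of_nonpos hy0 (by linarith [hv.1]) (by linarith)
  have hd : ∀ v ∈ Set.Icc (0 : ℝ) 1, HasDerivWithinAt
      (fun v : ℝ => (y : ℂ) ^ (-s) * v - ((y + v : ℝ) : ℂ) ^ (1 - s) / (1 - s))
      ((y : ℂ) ^ (-s) - ((y + v : ℝ) : ℂ) ^ (-s)) (Set.Icc 0 1) v := by
    intro v hv
    have h1 := hasDerivAt_ofReal_cpow_const' (hpos v hv).ne' (r := -s)
      (by intro h; apply hs1; linear_combination -h)
    have h2 := (h1.comp_const_add y v)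
    have h3 := ((hasDerivAt_id v).ofReal_comp.const_mul ((y : ℂ) ^ (-s))).sub h2
    simp only [ofReal_one, mul_one, neg_add_eq_sub] at h3
    exact h3.hasDerivWithinAt
  have := Convex.norm_image_sub_le_of_norm_hasDerivWithin_le hd (C := C) hder (convex_Icc 0 1)
      (x := 0) (y := 1) (by simp) (by simp)
  simp only [sub_zero, norm_one, mul_one] at this
  refine le_of_eq_of_le ?_ this
  rw [hurwitzRemainder]
  congr 1
  have e1 : s - 1 ≠ 0 := sub_ne_zero.2 hs1
  have e2 : 1 - s ≠ 0 := sub_ne_zero.2 hs1.symm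
  rw [show ((n : ℝ) + 1 + a) = y + 1 by rw [hy]; ring, ← hy]
  rw [show (1 - s) = -(s - 1) by ring]
  simp only [div_neg, add_zero, ofReal_zero, ofReal_one, mul_zero, mul_one]
  ring

lemma differentiableAt_hurwitzRemainder (ha : 0 < a) (n : ℕ) {s : ℂ} (hs1 : s ≠ 1) :
    DifferentiableAt ℂ (hurwitzRemainder a n) s := by
  have h1 : ((n + a : ℝ) : ℂ) ≠ 0 := ofReal_ne_zero.2 (by positivity)
  have h2 : ((n + 1 + a : ℝ) : ℂ) ≠ 0 := ofReal_ne_zero.2 (by positivity)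
  have e1 : s - 1 ≠ 0 := sub_ne_zero.2 hs1
  unfold hurwitzRemainder
  refine DifferentiableAt.sub ?_ (DifferentiableAt.div (DifferentiableAt.sub ?_ ?_) ?_ e1)
  · exact differentiableAt_id.neg.const_cpow (Or.inl h1)
  · exact ((differentiableAt_const _).sub differentiableAt_id).const_cpow (Or.inl h1)
  · exact ((differentiableAt_const _).sub differentiableAt_id).const_cpow (Or.inl h2)
  · exact differentiableAt_id.sub (differentiableAt_const _)

lemma sum_hurwitzRemainder (n : ℕ) (s : ℂ) :
    ∑ k ∈ Finset.range n, hurwitzRemainder a k s =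
      ∑ k ∈ Finset.range n, ((k + a : ℝ) : ℂ) ^ (-s) -
        ((a : ℂ) ^ (1 - s) - ((n + a : ℝ) : ℂ) ^ (1 - s)) / (s - 1) := by
  induction n with
  | zero => simp
  | succ n ih =>
    rw [Finset.sum_range_succ, Finset.sum_range_succ, ih, hurwitzRemainder]
    push_cast
    ring

lemma summable_add_rpow (ha : 0 < a) {p : ℝ} (hp : p < -1) :
    Summable fun n : ℕ => (n + a : ℝ) ^ p := by
  rw [← summable_nat_add_iff 1]
  have h : Summable fun n : ℕ => ((n + 1 : ℕ) : ℝ) ^ p :=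
    (summable_nat_add_iff 1).2 (Real.summable_nat_rpow.2 hp)
  refine Summable.of_nonneg_of_le (fun n => by positivity) (fun n => ?_) h
  refine Real.rpow_le_rpow_of_nonpos (by positivity) (by linarith) (by linarith)

lemma summable_hurwitzRemainder (ha : 0 < a) {s : ℂ} (hs : 0 < s.re) (hs1 : s ≠ 1) :
    Summable fun n => hurwitzRemainder a n s :=
  Summable.of_norm_bounded ((summable_add_rpow ha (by linarith)).mul_left _)
    fun n => norm_hurwitzRemainder_le ha n hs hs1

lemma differentiableAt_tsum_hurwitzRemainder (ha : 0 < a) (ha1 : a ≤ 1) {s : ℂ} (hs : 0 < s.re)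
    (hs1 : s ≠ 1) : DifferentiableAt ℂ (fun z => ∑' n, hurwitzRemainder a n z) s := by
  set U : Set ℂ := ({z | s.re / 2 < z.re} ∩ {z | z.re < s.re + 1}) ∩
    (Metric.ball 0 (‖s‖ + 1) ∩ {1}ᶜ) with hUdef
  have hU : IsOpen U :=
    ((isOpen_lt continuous_const continuous_re).inter (isOpen_lt continuous_re continuous_const)).inter
      (Metric.isOpen_ball.inter isOpen_compl_singleton)
  have hsU : s ∈ U := by
    refine ⟨⟨?_, ?_⟩, ?_, ?_⟩ <;> simp [hs, hs1]
  -- the term `n = 0` is treated separately since `a` may be less than one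
  have hb : ∀ (n : ℕ), ∀ z ∈ U, ‖hurwitzRemainder a n z‖ ≤
      (‖s‖ + 1) * (a ^ (-(s.re + 1) - 1) * (((n + a) / a : ℝ) ^ (-(s.re / 2) - 1))) := by
    intro n z hz
    obtain ⟨⟨h1, h2⟩, h3, h4⟩ := hz
    simp only [Set.mem_ofPred_eq] at h1 h2
    refine (norm_hurwitzRemainder_le ha n (by linarith) h4).trans ?_
    have e : ((n + a : ℝ)) = a * ((n + a) / a) := by field_simp
    have e1 : 1 ≤ ((n : ℝ) + a) / a := by
      rw [le_div_iff₀ ha]; have : (0 : ℝ) ≤ n := by positivity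
      linarith
    have e2 : ‖z‖ ≤ ‖s‖ + 1 := (mem_ball_zero_iff.1 h3).le
    rw [e, Real.mul_rpow ha.le (by positivity), ← e]
    gcongr ?_ * (?_ * ?_)
    · exact Real.rpow_le_rpow_of_exponent_ge ha ha1 (by linarith)
    · exact Real.rpow_le_rpow_of_exponent_le e1 (by linarith)
  have hsum : Summable fun n : ℕ =>
      (‖s‖ + 1) * (a ^ (-(s.re + 1) - 1) * (((n + a) / a : ℝ) ^ (-(s.re / 2) - 1))) := by
    refine Summable.mul_left _ (Summable.mul_left _ ?_)
    have := (summable_add_rpow ha (p := -(s.re / 2) - 1) (by linarith)).div_const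
      (a ^ (-(s.re / 2) - 1))
    refine this.congr fun n => ?_
    rw [Real.div_rpow (by positivity) ha.le]
  exact (differentiableOn_tsum_of_summable_norm hsum (fun n z hz =>
    (differentiableAt_hurwitzRemainder ha n hz.2.2).differentiableWithinAt) hU hb).differentiableAt
      (hU.mem_nhds hsU)

lemma tendsto_add_cpow_zero {s : ℂ} (hs : 1 < s.re) :
    Tendsto (fun n : ℕ => ((n + a : ℝ) : ℂ) ^ (1 - s)) atTop (nhds 0) := by
  rw [tendsto_zero_iff_norm_tendsto_zero]
  have h1 : Tendsto (fun n : ℕ => ((n : ℝ) + a)) atTop atTop :=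
    tendsto_atTop_add_const_right _ _ tendsto_natCast_atTop_atTop
  have h2 := (tendsto_rpow_neg_atTop (y := s.re - 1) (by linarith)).comp h1
  refine h2.congr' ?_
  filter_upwards [h1.eventually_gt_atTop 0] with n hn
  rw [norm_cpow_eq_rpow_re_of_pos hn]
  simp

lemma hurwitzZeta_eq_tsum (ha : 0 < a) (ha1 : a ≤ 1) {s : ℂ} (hs : 0 < s.re) (hi : s.im ≠ 0) :
    HurwitzZeta.hurwitzZeta (a : UnitAddCircle) s =
      (a : ℂ) ^ (1 - s) / (s - 1) + ∑' n, hurwitzRemainder a n s := by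
  refine eq_of_eq_of_one_lt_re (f := HurwitzZeta.hurwitzZeta (a : UnitAddCircle))
    (g := fun s => (a : ℂ) ^ (1 - s) / (s - 1) + ∑' n, hurwitzRemainder a n s)
    (fun s _ hi => HurwitzZeta.differentiableAt_hurwitzZeta _ (by rintro rfl; simp at hi))
    (fun s hs hi => ?_) (fun s hs => ?_) hs hi
  · have hs1 : s ≠ 1 := by rintro rfl; simp at hi
    refine DifferentiableAt.add (DifferentiableAt.div ?_ ?_ (sub_ne_zero.2 hs1))
      (differentiableAt_tsum_hurwitzRemainder ha ha1 hs hs1)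
    · exact ((differentiableAt_const _).sub differentiableAt_id).const_cpow
        (Or.inl (ofReal_ne_zero.2 ha.ne'))
    · exact differentiableAt_id.sub (differentiableAt_const _)
  · have hs1 : s ≠ 1 := by rintro rfl; simp at hs
    have h1 := (HurwitzZeta.hasSum_hurwitzZeta_of_one_lt_re (a := a) ⟨ha.le, ha1⟩
      hs).tendsto_sum_nat
    have h2 := (summable_hurwitzRemainder ha (by linarith) hs1).hasSum.tendsto_sum_nat
    have h3 := ((tendsto_add_cpow_zero (a := a) hs).div_const (s - 1))
    have h4 := (h2.const_add ((a : ℂ) ^ (1 - s) / (s - 1))).sub h3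
    simp only [zero_div, sub_zero] at h4
    refine tendsto_nhds_unique h1 (h4.congr fun n => ?_)
    rw [sum_hurwitzRemainder]
    simp only [cpow_neg, one_div]
    push_cast
    ring

lemma hurwitzZeta_eq_sum_add (ha : 0 < a) (ha1 : a ≤ 1) (N : ℕ) {s : ℂ} (hs : 0 < s.re)
    (hi : s.im ≠ 0) :
    HurwitzZeta.hurwitzZeta (a : UnitAddCircle) s =
      ∑ n ∈ Finset.range N, ((n + a : ℝ) : ℂ) ^ (-s) + ((N + a : ℝ) : ℂ) ^ (1 - s) / (s - 1) +
        ∑' n, hurwitzRemainder a (n + N) s := by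
  have hs1 : s ≠ 1 := by rintro rfl; simp at hi
  rw [hurwitzZeta_eq_tsum ha ha1 hs hi,
    ← (summable_hurwitzRemainder ha hs hs1).sum_add_tsum_nat_add N, sum_hurwitzRemainder]
  ring

end

section
variable {a : ℝ}

lemma rpow_neg_three_halves_le {y : ℝ} (hy : 1 ≤ y) :
    y ^ (-(3 / 2) : ℝ) ≤ 6 * (y ^ (-(1 / 2) : ℝ) - (y + 1) ^ (-(1 / 2) : ℝ)) := by
  have hy0 : 0 < y := by linarith
  have e1 : y ^ (-(3 / 2) : ℝ) = (y * √y)⁻¹ := by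
    rw [Real.rpow_neg hy0.le, show (3 / 2 : ℝ) = 1 + 1 / 2 by norm_num, Real.rpow_add hy0,
      Real.rpow_one, Real.sqrt_eq_rpow]
  rw [e1, Real.rpow_neg hy0.le, Real.rpow_neg (by linarith), ← Real.sqrt_eq_rpow,
    ← Real.sqrt_eq_rpow]
  set p := √y with hp
  set q := √(y + 1) with hq
  have hp2 : p ^ 2 = y := Real.sq_sqrt hy0.le
  have hq2 : q ^ 2 = y + 1 := Real.sq_sqrt (by linarith)
  have hp0 : 0 < p := Real.sqrt_pos.2 hy0
  have hq0 : 0 < q := Real.sqrt_pos.2 (by linarith)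
  have hpq : q ≤ 3 / 2 * p := by
    refine le_of_sq_le_sq ?_ (by positivity)
    nlinarith
  have e2 : p⁻¹ - q⁻¹ = (p * q * (p + q))⁻¹ := by
    have : (q - p) * (p + q) = 1 := by nlinarith
    field_simp
    linarith
  rw [e2, ← hp2, ← div_eq_mul_inv, inv_eq_one_div, div_le_div_iff₀ (by positivity) (by positivity)]
  have h1 : p * q * (p + q) ≤ p * (3 / 2 * p) * (p + 3 / 2 * p) := by gcongr
  nlinarith [pow_pos hp0 3]

lemma norm_tsum_hurwitzRemainder_le (ha : 0 < a) {N : ℕ} (hN : 1 ≤ N) {s : ℂ}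
    (hs : 1 / 2 ≤ s.re) (hs1 : s ≠ 1) :
    ‖∑' n, hurwitzRemainder a (n + N) s‖ ≤ 6 * ‖s‖ * (N : ℝ) ^ (-(1 / 2) : ℝ) := by
  have hs0 : 0 < s.re := by linarith
  have hN' : (1 : ℝ) ≤ N := by exact_mod_cast hN
  have hsum : Summable fun n => ‖hurwitzRemainder a (n + N) s‖ :=
    (summable_nat_add_iff N).2 (Summable.of_nonneg_of_le (fun _ => norm_nonneg _)
      (fun n => norm_hurwitzRemainder_le ha n hs0 hs1)
      ((summable_add_rpow ha (by linarith)).mul_left _))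
  refine (norm_tsum_le_tsum_norm hsum).trans ?_
  refine Real.tsum_le_of_sum_range_le (fun _ => norm_nonneg _) fun m => ?_
  have key : ∑ n ∈ Finset.range m, ‖hurwitzRemainder a (n + N) s‖ ≤
      6 * ‖s‖ * ((N : ℝ) ^ (-(1 / 2) : ℝ) - (m + N : ℝ) ^ (-(1 / 2) : ℝ)) := by
    induction m with
    | zero => simp
    | succ m ih =>
      rw [Finset.sum_range_succ]
      have h0 : (0 : ℝ) ≤ m := by positivity
      have h1 := norm_hurwitzRemainder_le ha (m + N) hs0 hs1
      have h2 : (((m + N : ℕ) : ℝ) + a) ^ (-s.re - 1) ≤ ((m : ℝ) + N) ^ (-(3 / 2) : ℝ) := by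
        push_cast
        refine (Real.rpow_le_rpow_of_nonpos (x := (m : ℝ) + N) (z := -s.re - 1) (by linarith)
          (by linarith) (by linarith)).trans ?_
        exact Real.rpow_le_rpow_of_exponent_le (by linarith) (by linarith)
      have h3 := h2.trans (rpow_neg_three_halves_le (by linarith))
      have h4 := mul_le_mul_of_nonneg_left h3 (norm_nonneg s)
      push_cast
      rw [show (m : ℝ) + 1 + N = m + N + 1 by ring]
      linarith
  refine key.trans ?_
  gcongr
  have : 0 ≤ (m + N : ℝ) ^ (-(1 / 2) : ℝ) := by positivity
  linarith

lemma sum_range_two_pow {E : Type*} [AddCommMonoid E] (f : ℕ → E) (k : ℕ) :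
    ∑ n ∈ Finset.range (2 ^ k), f n =
      f 0 + ∑ j ∈ Finset.range k, ∑ n ∈ Finset.Ico (2 ^ j) (2 * 2 ^ j), f n := by
  induction k with
  | zero => simp
  | succ k ih =>
    rw [Finset.sum_range_succ, ← add_assoc, ← ih, pow_succ', Finset.sum_range_add_sum_Ico]
    omega

lemma ofReal_cpow_neg_eq {y : ℝ} (hy : 0 < y) (σ t : ℝ) :
    (y : ℂ) ^ (-(σ + t * I : ℂ)) = ((y ^ (-σ) : ℝ) : ℂ) * exp ((-(t * Real.log y) : ℝ) * I) := by
  have hy' : (y : ℂ) ≠ 0 := ofReal_ne_zero.2 hy.ne'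
  rw [neg_add, cpow_add _ _ hy', ofReal_cpow hy.le, ofReal_neg, cpow_def_of_ne_zero hy' (-(t * I)),
    ← ofReal_log hy.le]
  congr 2
  push_cast
  ring

lemma norm_hurwitzZeta_le_of_le_two (ha : 0 < a) (ha1 : a ≤ 1) {σ t : ℝ} (hσ : 1 / 2 ≤ σ)
    (hσ2 : σ ≤ 2) (ht : 1 ≤ |t|) :
    ‖HurwitzZeta.hurwitzZeta (a : UnitAddCircle) (σ + t * I)‖ ≤
      (a ^ (-2 : ℝ) + 620) * ((1 + Real.log |t|) ^ 2 * |t| ^ (5 / 12 * max (1 - σ) 0)) := by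
  set τ := |t| with hτ
  set s : ℂ := σ + t * I with hs
  have hre : s.re = σ := by simp [hs]
  have him : s.im = t := by simp [hs]
  have ht0 : t ≠ 0 := by rintro rfl; simp at hτ; linarith
  have hs1 : s ≠ 1 := by rintro h; rw [h] at him; simp at him; exact ht0 him.symm
  set L := 1 + Real.log τ with hL
  have hL1 : 1 ≤ L := by have := Real.log_nonneg ht; linarith
  set E := τ ^ (5 / 12 * max (1 - σ) 0) with hE
  have hE1 : 1 ≤ E := Real.one_le_rpow ht (by positivity)
  obtain ⟨k, hk1, hk2⟩ := exists_nat_pow_near (x := τ ^ 2) (y := 2) (by nlinarith) one_lt_two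
  have hkL : ((k + 1 : ℕ) : ℝ) ≤ 3 * L := by
    have h1 := Real.log_le_log (by positivity) hk1
    rw [Real.log_pow, Real.log_pow] at h1
    have := Real.log_two_gt_d9
    have h0 := Real.log_nonneg ht
    have : (k : ℝ) * 0.69 ≤ k * Real.log 2 := by gcongr; linarith
    push_cast at h1 ⊢
    linarith
  set N : ℕ := 2 ^ (k + 1) with hN
  have hNτ : τ ^ 2 ≤ N := by rw [hN]; push_cast; exact hk2.le
  have hNτ' : (N : ℝ) ≤ 2 * τ ^ 2 := by rw [hN]; push_cast; rw [pow_succ]; linarith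
  have hN1 : 1 ≤ N := Nat.one_le_two_pow
  have hN1' : (1 : ℝ) ≤ N := by exact_mod_cast hN1
  have htail : ‖∑' n, hurwitzRemainder a (n + N) s‖ ≤ 18 := by
    refine (norm_tsum_hurwitzRemainder_le ha hN1 (by rwa [hre]) hs1).trans ?_
    have h1 : ‖s‖ ≤ 3 * τ := by
      refine (norm_le_abs_re_add_abs_im s).trans ?_
      rw [hre, him, abs_of_pos (by linarith)]
      linarith
    have h2 : (N : ℝ) ^ (-(1 / 2) : ℝ) ≤ 1 / τ := by
      rw [Real.rpow_neg (by positivity), ← Real.sqrt_eq_rpow, ← one_div]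
      gcongr
      exact Real.le_sqrt_of_sq_le hNτ
    calc 6 * ‖s‖ * (N : ℝ) ^ (-(1 / 2) : ℝ) ≤ 6 * (3 * τ) * (1 / τ) := by gcongr
      _ = 18 := by field_simp; norm_num
  have hmain : ‖((N + a : ℝ) : ℂ) ^ (1 - s) / (s - 1)‖ ≤ 2 := by
    rw [norm_div, norm_cpow_eq_rpow_re_of_pos (by linarith)]
    have h1 : τ ≤ ‖s - 1‖ := by
      have := abs_im_le_norm (s - 1)
      rwa [sub_im, one_im, sub_zero, him] at this
    rw [div_le_iff₀ (by linarith)]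
    calc (N + a : ℝ) ^ (1 - s).re ≤ (N + a : ℝ) ^ (1 / 2 : ℝ) := by
          refine Real.rpow_le_rpow_of_exponent_le (by linarith) ?_
          rw [sub_re, one_re, hre]; linarith
      _ ≤ 2 * τ := by
          rw [← Real.sqrt_eq_rpow]
          refine Real.sqrt_le_iff.2 ⟨by positivity, ?_⟩
          nlinarith
      _ ≤ _ := by gcongr
  have hfin : ‖∑ n ∈ Finset.range N, ((n + a : ℝ) : ℂ) ^ (-s)‖ ≤
      a ^ (-2 : ℝ) + 600 * (L ^ 2 * E) := by
    rw [hN, sum_range_two_pow]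
    refine (norm_add_le _ _).trans (add_le_add ?_ ?_)
    · rw [Nat.cast_zero, zero_add, norm_cpow_eq_rpow_re_of_pos ha, neg_re, hre]
      exact Real.rpow_le_rpow_of_exponent_ge ha ha1 (by linarith)
    · calc _ ≤ ∑ j ∈ Finset.range (k + 1), 200 * L * E := by
            refine norm_sum_le_of_le _ fun j hj => ?_
            have hj' : j ≤ k := by have := Finset.mem_range.1 hj; omega
            have h1 : ((2 ^ j : ℕ) : ℝ) ≤ 4 * |t| ^ 2 := by
              rw [← hτ]
              push_cast
              have : (2 : ℝ) ^ j ≤ 2 ^ k := pow_le_pow_right₀ (by norm_num) hj'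
              nlinarith
            refine le_of_eq_of_le ?_ (norm_dyadic_sum_le ha ha1 ht Nat.one_le_two_pow h1 hσ)
            congr 1
            refine Finset.sum_congr rfl fun n _ => ?_
            rw [hs, ofReal_cpow_neg_eq (by positivity)]
        _ = (k + 1 : ℕ) * (200 * L * E) := by simp
        _ ≤ 3 * L * (200 * L * E) := by gcongr
        _ = _ := by ring
  rw [hurwitzZeta_eq_sum_add ha ha1 N (by rw [hre]; linarith) (by rwa [him])]
  refine (norm_add_le _ _).trans ?_
  have h1 := norm_add_le (∑ n ∈ Finset.range N, ((n + a : ℝ) : ℂ) ^ (-s))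
    (((N + a : ℝ) : ℂ) ^ (1 - s) / (s - 1))
  have h2 : 1 ≤ L ^ 2 * E := one_le_mul_of_one_le_of_one_le (one_le_pow₀ hL1) hE1
  have h3 : 0 ≤ a ^ (-2 : ℝ) := by positivity
  nlinarith

end

/-- `F (σ + it)` is bounded by a constant multiple of `(1 + log|t|)² |t|^{5/12 (1-σ)⁺}`, uniformly
for `1/2 ≤ σ ≤ 2` and `|t| ≥ 1`. -/
def HasWeylBound (F : ℂ → ℂ) : Prop :=
  ∃ C : ℝ, ∀ σ t : ℝ, 1 / 2 ≤ σ → σ ≤ 2 → 1 ≤ |t| →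
    ‖F (σ + t * I)‖ ≤ C * ((1 + Real.log |t|) ^ 2 * |t| ^ (5 / 12 * max (1 - σ) 0))

lemma hasWeylBound_hurwitzZeta (a : UnitAddCircle) :
    HasWeylBound (HurwitzZeta.hurwitzZeta a) := by
  obtain ⟨b, hb, rfl⟩ : ∃ b ∈ Set.Ioc (0 : ℝ) 1, (b : UnitAddCircle) = a := by
    have := AddCircle.coe_image_Ioc_eq (1 : ℝ) 0
    have h : a ∈ ((↑) : ℝ → AddCircle (1 : ℝ)) '' Set.Ioc 0 (0 + 1) := by rw [this]; trivial
    simpa using h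
  exact ⟨_, fun σ t h1 h2 h3 => norm_hurwitzZeta_le_of_le_two hb.1 hb.2 h1 h2 h3⟩

lemma hasWeylBound_riemannZeta : HasWeylBound riemannZeta := by
  rw [← HurwitzZeta.hurwitzZeta_zero]
  exact hasWeylBound_hurwitzZeta 0

lemma hasWeylBound_LFunction {N : ℕ} [NeZero N] (Φ : ZMod N → ℂ) :
    HasWeylBound (ZMod.LFunction Φ) := by
  choose C hC using fun j : ZMod N => hasWeylBound_hurwitzZeta (ZMod.toAddCircle j)
  refine ⟨∑ j, ‖Φ j‖ * C j, fun σ t h1 h2 h3 => ?_⟩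
  rw [ZMod.LFunction, norm_mul, Finset.sum_mul]
  have hN : ‖(N : ℂ) ^ (-(σ + t * I : ℂ))‖ ≤ 1 := by
    have hN0 : 0 < N := NeZero.pos N
    rw [norm_natCast_cpow_of_pos hN0]
    exact Real.rpow_le_one_of_one_le_of_nonpos (by exact_mod_cast hN0) (by simp; linarith)
  refine (mul_le_of_le_one_left (norm_nonneg _) hN).trans (norm_sum_le_of_le _ fun j _ => ?_)
  rw [norm_mul, mul_assoc]
  exact mul_le_mul_of_nonneg_left (hC j σ t h1 h2 h3) (norm_nonneg _)

section

open NumberField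

variable {K : Type*} [Field K] [NumberField K]

lemma rK_zero : rK K 0 = 0 := by
  rw [rK, Nat.card_eq_zero]
  left
  exact ⟨fun ⟨I, h, h'⟩ => h' (Ideal.absNorm_eq_zero_iff.1 h)⟩

lemma rK_of_ne_zero {n : ℕ} (hn : n ≠ 0) :
    rK K n = {I : Ideal (𝓞 K) | Ideal.absNorm I = n}.ncard := by
  rw [rK, ← Nat.card_coe_set_eq]
  refine Nat.card_congr (Equiv.subtypeEquivRight fun I => ?_)
  refine and_iff_left_of_imp ?_
  rintro rfl rfl
  simp at hn

lemma rK_one : rK K 1 = 1 := by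
  rw [rK_of_ne_zero one_ne_zero]
  simp

lemma natCast_mem_of_absNorm_eq (I : Ideal (𝓞 K)) {m : ℕ} (h : Ideal.absNorm I = m) :
    (m : 𝓞 K) ∈ I := h ▸ Ideal.absNorm_mem I

omit [NumberField K] in
lemma sup_span_eq_top_of_coprime {m n : ℕ} (h : m.Coprime n) {L : Ideal (𝓞 K)}
    (hn : (n : 𝓞 K) ∈ L) : L ⊔ Ideal.span {(m : 𝓞 K)} = ⊤ := by
  rw [Ideal.eq_top_iff_one]
  have := Nat.gcd_eq_gcd_ab m n
  rw [h] at this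
  have h2 : (1 : 𝓞 K) = n * ((m.gcdB n : ℤ) : 𝓞 K) + m * ((m.gcdA n : ℤ) : 𝓞 K) := by
    have := congrArg (Int.cast : ℤ → 𝓞 K) this
    push_cast at this
    rw [this]; ring
  rw [h2]
  exact Submodule.add_mem_sup (Ideal.mul_mem_right _ _ hn)
    (Ideal.mul_mem_right _ _ (Ideal.mem_span_singleton_self _))

omit [NumberField K] in
lemma mul_sup_span_eq {m n : ℕ} (h : m.Coprime n) {J L : Ideal (𝓞 K)}
    (hJ : (m : 𝓞 K) ∈ J) (hL : (n : 𝓞 K) ∈ L) : J * L ⊔ Ideal.span {(m : 𝓞 K)} = J := by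
  refine le_antisymm (sup_le Ideal.mul_le_left ?_) ?_
  · rwa [Ideal.span_singleton_le_iff_mem]
  · calc J = J * (L ⊔ Ideal.span {(m : 𝓞 K)}) := by
          rw [sup_span_eq_top_of_coprime h hL, Ideal.mul_top]
      _ = J * L ⊔ J * Ideal.span {(m : 𝓞 K)} := Ideal.mul_sup _ _ _
      _ ≤ _ := sup_le_sup_left Ideal.mul_le_right _

lemma rK_mul {m n : ℕ} (h : m.Coprime n) : rK K (m * n) = rK K m * rK K n := by
  rcases eq_or_ne m 0 with rfl | hm
  · simp [rK_zero]
  rcases eq_or_ne n 0 with rfl | hn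
  · simp [rK_zero]
  rw [rK_of_ne_zero hm, rK_of_ne_zero hn, rK_of_ne_zero (mul_ne_zero hm hn), ← Set.ncard_prod]
  symm
  refine Set.ncard_congr (fun p _ => p.1 * p.2) ?_ ?_ ?_
  · rintro ⟨J, L⟩ ⟨hJ, hL⟩
    simp only [Set.mem_ofPred_eq] at hJ hL ⊢
    rw [map_mul, hJ, hL]
  · rintro ⟨J, L⟩ ⟨J', L'⟩ ⟨hJ, hL⟩ ⟨hJ', hL'⟩ e
    simp only at e
    have hJ := natCast_mem_of_absNorm_eq J hJ
    have hL := natCast_mem_of_absNorm_eq L hL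
    have hJ' := natCast_mem_of_absNorm_eq J' hJ'
    have hL' := natCast_mem_of_absNorm_eq L' hL'
    refine Prod.ext ?_ ?_
    · change J = J'
      rw [← mul_sup_span_eq h hJ hL, e, mul_sup_span_eq h hJ' hL']
    · change L = L'
      rw [← mul_sup_span_eq h.symm hL hJ, mul_comm, e, mul_comm, mul_sup_span_eq h.symm hL' hJ']
  · intro I hI
    have hI' : Ideal.absNorm I = m * n := hI
    have hmn : (m : 𝓞 K) * n ∈ I := by exact_mod_cast natCast_mem_of_absNorm_eq I hI'
    set J := I ⊔ Ideal.span {(m : 𝓞 K)} with hJdef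
    set L := I ⊔ Ideal.span {(n : 𝓞 K)} with hLdef
    have hmJ : (m : 𝓞 K) ∈ J := Ideal.mem_sup_right (Ideal.mem_span_singleton_self _)
    have hnL : (n : 𝓞 K) ∈ L := Ideal.mem_sup_right (Ideal.mem_span_singleton_self _)
    have hcop : J ⊔ L = ⊤ := by
      rw [eq_top_iff, ← sup_span_eq_top_of_coprime h hnL, sup_comm J L]
      exact sup_le_sup_left le_sup_right _
    have hJL : J * L = I := by
      refine le_antisymm ?_ ?_
      · rw [hJdef, hLdef, Ideal.sup_mul, Ideal.mul_sup (Ideal.span _)]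
        refine sup_le Ideal.mul_le_left (sup_le Ideal.mul_le_right ?_)
        rw [Ideal.span_singleton_mul_span_singleton, Ideal.span_singleton_le_iff_mem]
        exact hmn
      · rw [Ideal.mul_eq_inf_of_coprime hcop]
        exact le_inf le_sup_left le_sup_left
    have hnorm : Ideal.absNorm J * Ideal.absNorm L = m * n := by rw [← map_mul, hJL, hI']
    have hJm : Ideal.absNorm J ∣ m := by
      have h1 : Ideal.absNorm J ∣ m ^ Module.finrank ℤ (𝓞 K) := by
        rw [← Ideal.absNorm_span_natCast]
        exact Ideal.absNorm_dvd_absNorm_of_le le_sup_right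
      exact (((h.pow_left _).coprime_dvd_left h1)).dvd_of_dvd_mul_right (hnorm ▸ dvd_mul_right _ _)
    have hLn : Ideal.absNorm L ∣ n := by
      have h1 : Ideal.absNorm L ∣ n ^ Module.finrank ℤ (𝓞 K) := by
        rw [← Ideal.absNorm_span_natCast]
        exact Ideal.absNorm_dvd_absNorm_of_le le_sup_right
      exact (((h.symm.pow_left _).coprime_dvd_left h1)).dvd_of_dvd_mul_left
        (hnorm ▸ dvd_mul_left _ _)
    have hJ1 := Nat.le_of_dvd (Nat.pos_of_ne_zero hm) hJm
    have hL1 := Nat.le_of_dvd (Nat.pos_of_ne_zero hn) hLn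
    have hm0 := Nat.pos_of_ne_zero hm
    have hn0 := Nat.pos_of_ne_zero hn
    refine ⟨(J, L), ⟨?_, ?_⟩, hJL⟩
    · change Ideal.absNorm J = m
      nlinarith
    · change Ideal.absNorm L = n
      nlinarith

lemma LSeriesSummable_rK {s : ℂ} (hs : 1 < s.re) : LSeriesSummable (fun n => (rK K n : ℂ)) s := by
  have key : ∀ n : ℕ, ∑ k ∈ Finset.Icc 1 n, (rK K k : ℝ) =
      (Nat.card {I : Ideal (𝓞 K) // Ideal.absNorm I ≤ n} : ℝ) - 1 := by
    intro n
    have h1 : ∑ k ∈ Finset.Icc 1 n, rK K k + 1 =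
        Nat.card {I : Ideal (𝓞 K) // Ideal.absNorm I ≤ n} := by
      have e : ∀ k ∈ Finset.Icc 1 n, rK K k = Nat.card {I : Ideal (𝓞 K) // Ideal.absNorm I = k} := by
        intro k hk
        rw [rK_of_ne_zero (by have := (Finset.mem_Icc.1 hk).1; omega), ← Nat.card_coe_set_eq]
        rfl
      rw [Finset.sum_congr rfl e,
        show Finset.Icc 1 n = Finset.Ioc 0 n from Finset.Icc_succ_left_eq_Ioc _ _,
        show 1 = Nat.card {I : Ideal (𝓞 K) // Ideal.absNorm I = 0} by
          simp [Ideal.absNorm_eq_zero_iff],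
        Finset.sum_Ioc_add_eq_sum_Icc (n.zero_le),
        ← Finset.card_preimage_eq_sum_card_image_eq (fun k _ ↦ Ideal.finite_setOfPred_absNorm_eq k)]
      simp [Set.coe_eq_subtype]
    rw [← h1]; push_cast; ring
  have := LSeriesSummable_of_sum_norm_bigO_and_nonneg (f := fun n => (rK K n : ℝ)) (r := 1)
    (s := s) ?_ (fun _ => by positivity) zero_le_one hs
  · simpa using this
  · have h1 := ((NumberField.Ideal.tendsto_norm_le_div_atTop K).comp
      tendsto_natCast_atTop_atTop).isBigO_one ℝ
    have h2 := h1.mul (isBigO_refl (fun n : ℕ => (n : ℝ)) atTop)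
    refine IsBigO.trans ?_ (h2.congr_right fun n => by rw [one_mul, Real.rpow_one])
    refine IsBigO.of_bound 1 ?_
    filter_upwards [eventually_gt_atTop 0] with n hn
    have hn' : (0 : ℝ) < n := by exact_mod_cast hn
    rw [one_mul, Real.norm_of_nonneg (by positivity), Real.norm_of_nonneg (by simp; positivity),
      key]
    simp only [Function.comp, Nat.cast_le]
    rw [div_mul_cancel₀ _ hn'.ne']
    linarith

end

section

open NumberField

variable {K : Type*} [Field K] [NumberField K]

omit [NumberField K] in
lemma natCast_mem_of_pow_mem {p k : ℕ} {M : Ideal (𝓞 K)} (hM : M.IsMaximal)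
    (h : ((p ^ k : ℕ) : 𝓞 K) ∈ M) : (p : 𝓞 K) ∈ M := by
  push_cast at h
  exact hM.isPrime.mem_of_pow_mem _ h

lemma absNorm_ne_one {M : Ideal (𝓞 K)} (hM : M.IsMaximal) : Ideal.absNorm M ≠ 1 := by
  rw [Ne, Ideal.absNorm_eq_one_iff]
  exact hM.ne_top

lemma exists_pow_mul_pow_eq {p : ℕ} (hp : p.Prime) {P Q : Ideal (𝓞 K)}
    (hPQ : ∀ M : Ideal (𝓞 K), M.IsMaximal → (p : 𝓞 K) ∈ M → M = P ∨ M = Q) (k : ℕ) :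
    ∀ I : Ideal (𝓞 K), Ideal.absNorm I = p ^ k → ∃ i j : ℕ, I = P ^ i * Q ^ j := by
  induction k using Nat.strong_induction_on with
  | _ k ih =>
    intro I hI
    by_cases hI1 : I = ⊤
    · exact ⟨0, 0, by simp [hI1]⟩
    obtain ⟨M, hM, hIM⟩ := Ideal.exists_le_maximal I hI1
    have hpM := natCast_mem_of_pow_mem hM (hIM (natCast_mem_of_absNorm_eq I hI))
    obtain ⟨J, hJ⟩ := Ideal.dvd_iff_le.2 hIM
    have hn : Ideal.absNorm M * Ideal.absNorm J = p ^ k := by rw [← map_mul, ← hJ, hI]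
    obtain ⟨f, hf, hf'⟩ := (Nat.dvd_prime_pow hp).1 (hn ▸ dvd_mul_right _ _)
    obtain ⟨g, hg, hg'⟩ := (Nat.dvd_prime_pow hp).1 (hn ▸ dvd_mul_left _ _)
    have hfg : f + g = k := by
      rw [hf', hg', ← pow_add] at hn
      exact Nat.pow_right_injective hp.two_le hn
    have hf0 : f ≠ 0 := by
      rintro rfl
      exact absNorm_ne_one hM (by simpa using hf')
    obtain ⟨i, j, hij⟩ := ih g (by omega) J hg'
    rcases hPQ M hM hpM with rfl | rfl
    · exact ⟨i + 1, j, by rw [hJ, hij, pow_succ']; ring⟩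
    · exact ⟨i, j + 1, by rw [hJ, hij, pow_succ']; ring⟩

lemma primes_above_of_finrank_eq_two (hK2 : Module.finrank ℚ K = 2) {p : ℕ} (hp : p.Prime) :
    (∃ P : Ideal (𝓞 K), (Ideal.absNorm P = p ∨ Ideal.absNorm P = p ^ 2) ∧
      ∀ M : Ideal (𝓞 K), M.IsMaximal → (p : 𝓞 K) ∈ M → M = P) ∨
    (∃ P Q : Ideal (𝓞 K), P.IsMaximal ∧ Q.IsMaximal ∧ P ≠ Q ∧ Ideal.absNorm P = p ∧
      Ideal.absNorm Q = p ∧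
      ∀ M : Ideal (𝓞 K), M.IsMaximal → (p : 𝓞 K) ∈ M → M = P ∨ M = Q) := by
  have hN : Ideal.absNorm (Ideal.span {(p : 𝓞 K)}) = p ^ 2 := by
    rw [Ideal.absNorm_span_natCast, RingOfIntegers.rank, hK2]
  have htop : Ideal.span {(p : 𝓞 K)} ≠ ⊤ := by
    rw [Ne, ← Ideal.absNorm_eq_one_iff, hN]
    have := hp.one_lt
    nlinarith
  have hnorm : ∀ M : Ideal (𝓞 K), M.IsMaximal → (p : 𝓞 K) ∈ M →
      Ideal.absNorm M = p ∨ Ideal.absNorm M = p ^ 2 := by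
    intro M hM hpM
    have h1 : Ideal.absNorm M ∣ p ^ 2 :=
      hN ▸ Ideal.absNorm_dvd_absNorm_of_le ((Ideal.span_singleton_le_iff_mem _).2 hpM)
    obtain ⟨f, hf, hf'⟩ := (Nat.dvd_prime_pow hp).1 h1
    have hf0 : f ≠ 0 := by
      rintro rfl
      exact absNorm_ne_one hM (by simpa using hf')
    have : f = 1 ∨ f = 2 := by omega
    rcases this with rfl | rfl
    · left; simpa using hf'
    · right; exact hf'
  obtain ⟨P, hP, hpP⟩ := Ideal.exists_le_maximal _ htop
  rw [Ideal.span_singleton_le_iff_mem] at hpP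
  by_cases huniq : ∀ M : Ideal (𝓞 K), M.IsMaximal → (p : 𝓞 K) ∈ M → M = P
  · exact Or.inl ⟨P, hnorm P hP hpP, huniq⟩
  push Not at huniq
  obtain ⟨Q, hQ, hpQ, hQP⟩ := huniq
  right
  have hcop : P ⊔ Q = ⊤ := hP.coprime_of_ne hQ hQP.symm
  have hle : Ideal.span {(p : 𝓞 K)} ≤ P * Q := by
    rw [Ideal.mul_eq_inf_of_coprime hcop, Ideal.span_singleton_le_iff_mem]
    exact ⟨hpP, hpQ⟩
  have hdvd : Ideal.absNorm P * Ideal.absNorm Q ∣ p ^ 2 := by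
    rw [← map_mul, ← hN]
    exact Ideal.absNorm_dvd_absNorm_of_le hle
  have hlt := Nat.le_of_dvd (pow_pos hp.pos _) hdvd
  have hp1 := hp.one_lt
  have hP1 : Ideal.absNorm P = p := by
    rcases hnorm P hP hpP with h | h
    · exact h
    · rcases hnorm Q hQ hpQ with h' | h' <;> rw [h, h'] at hlt <;> nlinarith [pow_pos hp.pos 2]
  have hQ1 : Ideal.absNorm Q = p := by
    rcases hnorm Q hQ hpQ with h | h
    · exact h
    · rw [hP1, h] at hlt
      nlinarith [pow_pos hp.pos 2]
  have heq : Ideal.span {(p : 𝓞 K)} = P * Q := by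
    obtain ⟨J, hJ⟩ := Ideal.dvd_iff_le.2 hle
    have h1 := congrArg Ideal.absNorm hJ
    rw [hN, map_mul, map_mul, hP1, hQ1, ← sq] at h1
    have h2 : Ideal.absNorm J = 1 := by
      have := pow_pos hp.pos 2
      exact Nat.eq_of_mul_eq_mul_left this (by rw [← h1, mul_one])
    rw [hJ, Ideal.absNorm_eq_one_iff.1 h2, Ideal.mul_top]
  refine ⟨P, Q, hP, hQ, hQP.symm, hP1, hQ1, fun M hM hpM => ?_⟩
  have h1 : P * Q ≤ M := by rw [← heq, Ideal.span_singleton_le_iff_mem]; exact hpM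
  rcases hM.isPrime.mul_le.1 h1 with h | h
  · exact Or.inl (hP.eq_of_le hM.ne_top h).symm
  · exact Or.inr (hQ.eq_of_le hM.ne_top h).symm

lemma exists_rK_prime_pow (hK2 : Module.finrank ℚ K = 2) {p : ℕ} (hp : p.Prime) :
    ∃ c : ℤ, (c = -1 ∨ c = 0 ∨ c = 1) ∧
      (∀ k, (rK K (p ^ k) : ℤ) = ∑ i ∈ Finset.range (k + 1), c ^ i) ∧
      ((∃ M N : Ideal (𝓞 K), M.IsMaximal ∧ N.IsMaximal ∧ (p : 𝓞 K) ∈ M ∧ (p : 𝓞 K) ∈ N ∧ M ≠ N) →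
        c = 1) := by
  have hpk : ∀ k, p ^ k ≠ 0 := fun k => pow_ne_zero _ hp.ne_zero
  have hinj := Nat.pow_right_injective hp.two_le
  rcases primes_above_of_finrank_eq_two hK2 hp with ⟨P, hPn, hP⟩ | ⟨P, Q, hP, hQ, hne, hP1, hQ1, hPQ⟩
  · have huniq : (∃ M N : Ideal (𝓞 K), M.IsMaximal ∧ N.IsMaximal ∧ (p : 𝓞 K) ∈ M ∧
        (p : 𝓞 K) ∈ N ∧ M ≠ N) → False := by
      rintro ⟨M, N, hM, hN, hpM, hpN, hne⟩
      exact hne ((hP M hM hpM).trans (hP N hN hpN).symm)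
    have hex : ∀ k (I : Ideal (𝓞 K)), Ideal.absNorm I = p ^ k → ∃ i, I = P ^ i := by
      intro k I hI
      obtain ⟨i, j, h⟩ := exists_pow_mul_pow_eq hp (Q := P) (fun M hM h => Or.inl (hP M hM h)) k I hI
      exact ⟨i + j, by rw [h, pow_add]⟩
    rcases hPn with hPn | hPn
    · refine ⟨0, by simp, fun k => ?_, fun h => (huniq h).elim⟩
      have : {I : Ideal (𝓞 K) | Ideal.absNorm I = p ^ k} = {P ^ k} := by
        ext I
        simp only [Set.mem_ofPred_eq, Set.mem_singleton_iff]
        constructor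
        · intro hI
          obtain ⟨i, rfl⟩ := hex k I hI
          rw [map_pow, hPn] at hI
          rw [hinj hI]
        · rintro rfl
          rw [map_pow, hPn]
      rw [rK_of_ne_zero (hpk k), this, Set.ncard_singleton, Finset.sum_range_succ']
      simp
    · refine ⟨-1, by simp, fun k => ?_, fun h => (huniq h).elim⟩
      rw [rK_of_ne_zero (hpk k), neg_one_geom_sum]
      rcases Nat.even_or_odd k with hk | hk
      · obtain ⟨r, rfl⟩ := hk
        have : {I : Ideal (𝓞 K) | Ideal.absNorm I = p ^ (r + r)} = {P ^ r} := by
          ext I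
          simp only [Set.mem_ofPred_eq, Set.mem_singleton_iff]
          constructor
          · intro hI
            obtain ⟨i, rfl⟩ := hex _ I hI
            rw [map_pow, hPn, ← pow_mul] at hI
            have := hinj hI
            rw [show i = r by omega]
          · rintro rfl
            rw [map_pow, hPn, ← pow_mul, two_mul]
        rw [this, Set.ncard_singleton, if_neg (by simp [Nat.even_add_one])]
        simp
      · have : {I : Ideal (𝓞 K) | Ideal.absNorm I = p ^ k} = ∅ := by
          ext I
          simp only [Set.mem_ofPred_eq, Set.mem_empty_iff_false, iff_false]
          intro hI
          obtain ⟨i, rfl⟩ := hex _ I hI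
          rw [map_pow, hPn, ← pow_mul] at hI
          have := hinj hI
          obtain ⟨r, rfl⟩ := hk
          omega
        rw [this, Set.ncard_empty, if_pos (by simpa [Nat.even_add_one] using hk)]
        simp
  · refine ⟨1, by simp, fun k => ?_, fun _ => rfl⟩
    have hP0 : P ≠ 0 := by
      rintro rfl
      rw [Ideal.zero_eq_bot, Ideal.absNorm_bot] at hP1
      exact hp.ne_zero hP1.symm
    have key : ∀ i i' j j' : ℕ, i < i' → P ^ i * Q ^ j ≠ P ^ i' * Q ^ j' := by
      intro i i' j j' hii e
      obtain ⟨m, rfl⟩ := Nat.exists_eq_add_of_lt hii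
      rw [add_assoc, pow_add, mul_assoc] at e
      have e := mul_left_cancel₀ (pow_ne_zero i hP0) e
      have h1 : Q ^ j ≤ P := by
        rw [e, pow_succ']
        exact Ideal.mul_le_left.trans Ideal.mul_le_left
      have h2 : Q ≤ P := hP.isPrime.le_of_pow_le h1
      exact hne (hQ.eq_of_le hP.ne_top h2).symm
    have : {I : Ideal (𝓞 K) | Ideal.absNorm I = p ^ k} =
        (fun i => P ^ i * Q ^ (k - i)) '' (Finset.range (k + 1) : Set ℕ) := by
      ext I
      simp only [Set.mem_ofPred_eq, Set.mem_image, Finset.coe_range, Set.mem_Iio]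
      constructor
      · intro hI
        obtain ⟨i, j, rfl⟩ := exists_pow_mul_pow_eq hp hPQ k I hI
        rw [map_mul, map_pow, map_pow, hP1, hQ1, ← pow_add] at hI
        have := hinj hI
        exact ⟨i, by omega, by rw [show k - i = j by omega]⟩
      · rintro ⟨i, hi, rfl⟩
        rw [map_mul, map_pow, map_pow, hP1, hQ1, ← pow_add]
        congr 1; omega
    rw [rK_of_ne_zero (hpk k), this, Set.ncard_image_of_injective, Set.ncard_coe_finset]
    · simp
    · intro i i' e
      rcases lt_trichotomy i i' with h | h | h
      · exact (key _ _ _ _ h e).elim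
      · exact h
      · exact (key _ _ _ _ h e.symm).elim

end

section

open NumberField

variable {K : Type*} [Field K] [NumberField K]

lemma finrank_ringOfIntegers_eq_two (hK2 : Module.finrank ℚ K = 2) :
    Module.finrank ℤ (𝓞 K) = 2 := by rw [RingOfIntegers.rank, hK2]

lemma exists_sq_sub_trace_mul_eq (hK2 : Module.finrank ℚ K = 2) (β : 𝓞 K) :
    ∃ n : ℤ, β ^ 2 - (Algebra.trace ℤ (𝓞 K) β : 𝓞 K) * β + n = 0 := by
  let b : Module.Basis (Fin 2) ℤ (𝓞 K) :=
    (Module.finBasisOfFinrankEq ℤ (𝓞 K) (finrank_ringOfIntegers_eq_two hK2))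
  refine ⟨(Algebra.leftMulMatrix b β).det, ?_⟩
  have h := Matrix.aeval_self_charpoly (Algebra.leftMulMatrix b β)
  rw [Matrix.charpoly_fin_two] at h
  apply Algebra.leftMulMatrix_injective b
  rw [Algebra.trace_eq_matrix_trace b]
  simp only [map_add, map_sub, map_pow, map_mul, Polynomial.aeval_X, Polynomial.aeval_C,
    map_zero] at h ⊢
  simpa using h

lemma exists_two_mul_sub_trace_ne_zero (hK2 : Module.finrank ℚ K = 2) :
    ∃ β : 𝓞 K, 2 * β - (Algebra.trace ℤ (𝓞 K) β : 𝓞 K) ≠ 0 := by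
  by_contra! h
  obtain ⟨b⟩ : Nonempty (Module.Basis (Fin 2) ℤ (𝓞 K)) :=
    ⟨Module.finBasisOfFinrankEq ℤ (𝓞 K) (finrank_ringOfIntegers_eq_two hK2)⟩
  have h0 := h (b 0)
  have h1 := h (b 1)
  generalize Algebra.trace ℤ (𝓞 K) (b 0) = T₀ at h0
  generalize Algebra.trace ℤ (𝓞 K) (b 1) = T₁ at h1
  have h2 : ∑ i, (![2 * T₁, -(2 * T₀)] : Fin 2 → ℤ) i • b i = 0 := by
    simp only [Fin.sum_univ_two, zsmul_eq_mul, Matrix.cons_val_zero, Matrix.cons_val_one]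
    push_cast
    linear_combination (T₁ : 𝓞 K) * h0 - (T₀ : 𝓞 K) * h1
  have h4 : -(2 * T₀) = 0 := Fintype.linearIndependent_iff.1 b.linearIndependent _ h2 1
  have h5 : T₀ = 0 := by omega
  rw [h5, Int.cast_zero, sub_zero] at h0
  exact b.ne_zero 0 ((mul_eq_zero.1 h0).resolve_left two_ne_zero)

lemma trace_intCast (hK2 : Module.finrank ℚ K = 2) (c : ℤ) :
    Algebra.trace ℤ (𝓞 K) (c : 𝓞 K) = 2 * c := by
  have := Algebra.trace_algebraMap (S := 𝓞 K) c
  rw [finrank_ringOfIntegers_eq_two hK2] at this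
  simpa using this

lemma exists_sq_eq_intCast (hK2 : Module.finrank ℚ K = 2) :
    ∃ (α : 𝓞 K) (d : ℤ), d ≠ 0 ∧ α ^ 2 = d ∧ Algebra.trace ℤ (𝓞 K) α = 0 := by
  obtain ⟨β, hβ⟩ := exists_two_mul_sub_trace_ne_zero hK2
  obtain ⟨n, hn⟩ := exists_sq_sub_trace_mul_eq hK2 β
  have htr : Algebra.trace ℤ (𝓞 K) (2 * β - (Algebra.trace ℤ (𝓞 K) β : 𝓞 K)) = 0 := by
    rw [map_sub, trace_intCast hK2, two_mul, map_add]; ring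
  generalize Algebra.trace ℤ (𝓞 K) β = T at *
  have hsq : (2 * β - (T : 𝓞 K)) ^ 2 = ((T ^ 2 - 4 * n : ℤ) : 𝓞 K) := by
    push_cast
    linear_combination 4 * hn
  refine ⟨2 * β - (T : 𝓞 K), T ^ 2 - 4 * n, ?_, hsq, htr⟩
  intro h
  rw [h, Int.cast_zero] at hsq
  exact hβ (pow_eq_zero_iff two_ne_zero |>.1 hsq)

omit [NumberField K] in
lemma trace_natCast_mul (p : ℕ) (z : 𝓞 K) :
    Algebra.trace ℤ (𝓞 K) ((p : 𝓞 K) * z) = p * Algebra.trace ℤ (𝓞 K) z := by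
  rw [← nsmul_eq_mul, map_nsmul, nsmul_eq_mul]

lemma span_pair_ne_top (hK2 : Module.finrank ℚ K = 2) {α : 𝓞 K} {d : ℤ} (hα : α ^ 2 = d)
    (htr : Algebra.trace ℤ (𝓞 K) α = 0) {p : ℕ} {c : ℤ} (hc : (p : ℤ) ∣ d - c ^ 2)
    (hpc : ¬ (p : ℤ) ∣ 2 * c) : Ideal.span {(p : 𝓞 K), α - c} ≠ ⊤ := by
  intro h
  have h1 : (1 : 𝓞 K) ∈ Ideal.span {(p : 𝓞 K), α - c} := h ▸ Submodule.mem_top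
  obtain ⟨x, y, hxy⟩ := Ideal.mem_span_pair.1 h1
  obtain ⟨e, he⟩ := hc
  have he' : (d : 𝓞 K) - c ^ 2 = p * e := by exact_mod_cast congrArg (Int.cast : ℤ → 𝓞 K) he
  have h2 : α + c = (p : 𝓞 K) * (x * (α + c) + e * y) := by
    linear_combination (-(α + c)) * hxy + y * hα + y * he'
  have h3 := congrArg (Algebra.trace ℤ (𝓞 K)) h2
  rw [trace_natCast_mul, map_add, htr, trace_intCast hK2, zero_add] at h3
  exact hpc ⟨_, h3⟩

lemma exists_ne_maximal (hK2 : Module.finrank ℚ K = 2) {α : 𝓞 K} {d : ℤ} (hα : α ^ 2 = d)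
    (htr : Algebra.trace ℤ (𝓞 K) α = 0) {p : ℕ} (hp : p.Prime) {c : ℤ} (hc : (p : ℤ) ∣ d - c ^ 2)
    (hpc : ¬ (p : ℤ) ∣ 2 * c) :
    ∃ M N : Ideal (𝓞 K), M.IsMaximal ∧ N.IsMaximal ∧ (p : 𝓞 K) ∈ M ∧ (p : 𝓞 K) ∈ N ∧ M ≠ N := by
  obtain ⟨M, hM, hMle⟩ := Ideal.exists_le_maximal _ (span_pair_ne_top hK2 hα htr hc hpc)
  obtain ⟨N, hN, hNle⟩ := Ideal.exists_le_maximal _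
    (span_pair_ne_top hK2 hα htr (p := p) (c := -c) (by simpa using hc) (by simpa using hpc))
  have hpM : (p : 𝓞 K) ∈ M := hMle (Ideal.subset_span (by simp))
  have hpN : (p : 𝓞 K) ∈ N := hNle (Ideal.subset_span (by simp))
  refine ⟨M, N, hM, hN, hpM, hpN, ?_⟩
  rintro rfl
  have h1 : α - c ∈ M := hMle (Ideal.subset_span (by simp))
  have h2 : α - ((-c : ℤ) : 𝓞 K) ∈ M := hNle (Ideal.subset_span (by simp))
  have h3 : ((2 * c : ℤ) : 𝓞 K) ∈ M := by
    have := M.sub_mem h2 h1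
    push_cast at this ⊢
    convert this using 1; ring
  have hcop : IsCoprime (p : ℤ) (2 * c) :=
    (Nat.prime_iff_prime_int.1 hp).coprime_iff_not_dvd.2 hpc
  obtain ⟨u, v, huv⟩ := hcop
  refine hM.ne_top ((Ideal.eq_top_iff_one _).2 ?_)
  have : (1 : 𝓞 K) = u * p + v * ((2 * c : ℤ) : 𝓞 K) := by
    exact_mod_cast congrArg (Int.cast : ℤ → 𝓞 K) huv.symm
  rw [this]
  exact M.add_mem (M.mul_mem_left _ hpM) (M.mul_mem_left _ h3)

lemma rK_prime_eq_zero {α : 𝓞 K} {d : ℤ} (hα : α ^ 2 = d) {p : ℕ} [Fact p.Prime]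
    (hd : ¬ IsSquare (d : ZMod p)) : rK K p = 0 := by
  have hp : p.Prime := Fact.out
  rw [rK, Nat.card_eq_zero]
  left
  refine ⟨fun ⟨I, hI, _⟩ => hd ?_⟩
  have hcard : Nat.card (𝓞 K ⧸ I) = p := by
    rw [← hI, Ideal.absNorm_apply, Submodule.cardQuot_apply]
  have : Finite (𝓞 K ⧸ I) := Nat.finite_of_card_ne_zero (by rw [hcard]; exact hp.ne_zero)
  have : Fintype (𝓞 K ⧸ I) := Fintype.ofFinite _
  let e := ZMod.ringEquivOfPrime (𝓞 K ⧸ I) hp (by rw [← Nat.card_eq_fintype_card, hcard])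
  refine ⟨e.symm (Ideal.Quotient.mk I α), ?_⟩
  rw [← map_mul, ← map_mul, ← sq, hα, map_intCast, map_intCast]

lemma exists_rK_prime_pow_jacobiSym (hK2 : Module.finrank ℚ K = 2) {α : 𝓞 K} {d : ℤ}
    (hα : α ^ 2 = d) (htr : Algebra.trace ℤ (𝓞 K) α = 0) {p : ℕ} (hp : p.Prime) :
    ∃ c : ℤ, (c = -1 ∨ c = 0 ∨ c = 1) ∧
      (∀ k, (rK K (p ^ k) : ℤ) = ∑ i ∈ Finset.range (k + 1), c ^ i) ∧
      (¬ (p : ℤ) ∣ 2 * d → c = jacobiSym d p) := by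
  obtain ⟨c, hc, hpow, hsplit⟩ := exists_rK_prime_pow hK2 hp
  refine ⟨c, hc, hpow, fun hpd => ?_⟩
  have : Fact p.Prime := ⟨hp⟩
  have hpd' : (d : ZMod p) ≠ 0 := by
    rw [Ne, ZMod.intCast_zmod_eq_zero_iff_dvd]
    exact fun h => hpd (h.mul_left _)
  rw [← jacobiSym.legendreSym.to_jacobiSym]
  by_cases hsq : IsSquare (d : ZMod p)
  · rw [(legendreSym.eq_one_iff p hpd').2 hsq]
    apply hsplit
    obtain ⟨r, hr⟩ := hsq
    obtain ⟨x, rfl⟩ := ZMod.intCast_surjective r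
    have hx : (p : ℤ) ∣ d - x ^ 2 := by
      rw [← ZMod.intCast_zmod_eq_zero_iff_dvd]
      push_cast
      rw [hr]; ring
    refine exists_ne_maximal hK2 hα htr hp hx fun h => hpd ?_
    have h2 : (p : ℤ) ∣ 2 * (d - x ^ 2) + 2 * x * x := dvd_add (hx.mul_left _) (h.mul_right _)
    convert h2 using 1
    ring
  · rw [(legendreSym.eq_neg_one_iff p).2 hsq]
    have h1 := hpow 1
    rw [pow_one, rK_prime_eq_zero hα hsq] at h1
    simp [Finset.sum_range_succ] at h1
    linarith

end

/-- The completely multiplicative function sending odd `n` to the Jacobi symbol `(d / n)` and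
even `n` to `0`. -/
noncomputable def oddJacobi (d : ℤ) : ℕ →*₀ ℂ where
  toFun n := if Odd n then (jacobiSym d n : ℂ) else 0
  map_zero' := by simp
  map_one' := by simp
  map_mul' m n := by
    by_cases hm : Odd m
    · by_cases hn : Odd n
      · rw [if_pos hm, if_pos hn, if_pos (hm.mul hn),
          jacobiSym.mul_right' d hm.pos.ne' hn.pos.ne', Int.cast_mul]
      · rw [if_neg hn, mul_zero, if_neg fun h => hn (Nat.odd_mul.1 h).2]
    · rw [if_neg hm, zero_mul, if_neg fun h => hm (Nat.odd_mul.1 h).1]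

lemma oddJacobi_apply (d : ℤ) (n : ℕ) :
    oddJacobi d n = if Odd n then (jacobiSym d n : ℂ) else 0 := rfl

lemma norm_oddJacobi_le_one (d : ℤ) (n : ℕ) : ‖oddJacobi d n‖ ≤ 1 := by
  rw [oddJacobi_apply]
  split_ifs
  · rcases jacobiSym.trichotomy d n with h | h | h <;> simp [h]
  · simp

lemma oddJacobi_mod (d : ℤ) (n : ℕ) : oddJacobi d (n % (4 * d.natAbs)) = oddJacobi d n := by
  have h : Odd (n % (4 * d.natAbs)) ↔ Odd n :=
    Odd.mod_even_iff (by rw [show 4 * d.natAbs = 2 * (2 * d.natAbs) by ring]; exact even_two_mul _)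
  rw [oddJacobi_apply, oddJacobi_apply]
  by_cases hn : Odd n
  · rw [if_pos (h.2 hn), if_pos hn, jacobiSym.mod_right d hn]
  · rw [if_neg (fun h' => hn (h.1 h')), if_neg hn]

lemma oddJacobi_val_natCast (d : ℤ) (n : ℕ) :
    oddJacobi d (n : ZMod (4 * d.natAbs)).val = oddJacobi d n := by
  rw [ZMod.val_natCast, oddJacobi_mod]

lemma term_eq_mul_cpow_neg {f : ℕ → ℂ} (hf : f 0 = 0) (s : ℂ) (n : ℕ) :
    LSeries.term f s n = f n * (n : ℂ) ^ (-s) := by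
  rw [LSeries.term_def]
  split_ifs with h
  · rw [h, hf, zero_mul]
  · rw [cpow_neg, div_eq_mul_inv]

lemma LSeries_eulerProduct_hasProd_of_monoidWithZeroHom (χ : ℕ →*₀ ℂ) {s : ℂ}
    (hs : LSeriesSummable χ s) :
    HasProd (fun p : Nat.Primes => (1 - χ p * (p : ℂ) ^ (-s))⁻¹) (LSeries χ s) := by
  have hterm := term_eq_mul_cpow_neg (f := χ) (map_zero χ) s
  let f : ℕ →*₀ ℂ :=
    { toFun := fun n => χ n * (n : ℂ) ^ (-s)
      map_zero' := by simp
      map_one' := by simp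
      map_mul' := fun m n => by
        rw [map_mul, Nat.cast_mul, natCast_mul_natCast_cpow]; ring }
  have h := EulerProduct.eulerProduct_completely_multiplicative_hasProd (f := f)
    (hs.norm.congr fun n => by rw [hterm]; rfl)
  have h2 : ∑' n, f n = LSeries χ s := tsum_congr fun n => (hterm n).symm
  rw [h2] at h
  exact h

lemma tsum_sum_range_pow_mul_pow {c z : ℂ} (hc : ‖c‖ ≤ 1) (hz : ‖z‖ < 1) :
    ∑' k : ℕ, (∑ i ∈ Finset.range (k + 1), c ^ i) * z ^ k = (1 - z)⁻¹ * (1 - c * z)⁻¹ := by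
  have hcz : ‖c * z‖ < 1 := by
    rw [norm_mul]; exact (mul_le_of_le_one_left (norm_nonneg _) hc).trans_lt hz
  rw [mul_comm, ← tsum_geometric_of_norm_lt_one hz, ← tsum_geometric_of_norm_lt_one hcz,
    tsum_mul_tsum_eq_tsum_sum_range_of_summable_norm]
  · refine tsum_congr fun k => ?_
    rw [Finset.sum_mul]
    refine Finset.sum_congr rfl fun i hi => ?_
    have : i ≤ k := by have := Finset.mem_range.1 hi; omega
    rw [mul_pow, mul_assoc, ← pow_add, Nat.add_sub_cancel' this]
  · exact (summable_geometric_of_norm_lt_one hcz).norm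
  · exact (summable_geometric_of_norm_lt_one hz).norm

lemma norm_prime_cpow_neg_lt_one {p : ℕ} (hp : p.Prime) {s : ℂ} (hs : 0 < s.re) :
    ‖(p : ℂ) ^ (-s)‖ < 1 := by
  rw [norm_natCast_cpow_of_pos hp.pos]
  exact Real.rpow_lt_one_of_one_lt_of_neg (by exact_mod_cast hp.one_lt) (by simpa using hs)

lemma one_sub_mul_ne_zero {c z : ℂ} (hc : ‖c‖ ≤ 1) (hz : ‖z‖ < 1) : 1 - c * z ≠ 0 := by
  intro h
  have h1 : ‖c * z‖ < 1 := by
    rw [norm_mul]; exact (mul_le_of_le_one_left (norm_nonneg _) hc).trans_lt hz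
  rw [← sub_eq_zero.1 h, norm_one] at h1
  exact lt_irrefl _ h1

section
variable {K : Type*} [Field K] [NumberField K]

lemma rK_eulerProduct_hasProd {c : Nat.Primes → ℂ} (hc : ∀ p, ‖c p‖ ≤ 1)
    (hr : ∀ (p : Nat.Primes) (k : ℕ), (rK K (p ^ k) : ℂ) = ∑ i ∈ Finset.range (k + 1), c p ^ i)
    {s : ℂ} (hs : 1 < s.re) :
    HasProd (fun p : Nat.Primes => (1 - (p : ℂ) ^ (-s))⁻¹ * (1 - c p * (p : ℂ) ^ (-s))⁻¹)
      (LSeries (fun n => (rK K n : ℂ)) s) := by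
  have hterm := term_eq_mul_cpow_neg (f := fun n => (rK K n : ℂ)) (by simp [rK_zero]) s
  have h := EulerProduct.eulerProduct_hasProd
    (f := LSeries.term (fun n => (rK K n : ℂ)) s) (by simp [rK_one])
    (fun {m n} hmn => by
      simp only [hterm]
      rw [rK_mul hmn, Nat.cast_mul, Nat.cast_mul, natCast_mul_natCast_cpow]; ring)
    (LSeriesSummable_rK hs).norm (by simp)
  change HasProd _ (∑' n, LSeries.term (fun n => (rK K n : ℂ)) s n)
  convert h using 2 with p
  rw [← tsum_sum_range_pow_mul_pow (hc p) (norm_prime_cpow_neg_lt_one p.2 (by linarith))]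
  refine tsum_congr fun k => ?_
  rw [hterm, hr, Nat.cast_pow, ← natCast_cpow_natCast_mul, mul_comm (k : ℂ), cpow_mul_nat]

lemma exists_LSeries_rK_eq (hK2 : Module.finrank ℚ K = 2) :
    ∃ (N : ℕ) (_ : NeZero N) (Φ : ZMod N → ℂ) (S : Finset Nat.Primes) (a c : Nat.Primes → ℂ),
      (∀ p, ‖a p‖ ≤ 1) ∧ (∀ p, ‖c p‖ ≤ 1) ∧ ∀ s : ℂ, 1 < s.re →
        LSeries (fun n => (rK K n : ℂ)) s = riemannZeta s * ZMod.LFunction Φ s *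
          ∏ p ∈ S, (1 - a p * (p : ℂ) ^ (-s)) * (1 - c p * (p : ℂ) ^ (-s))⁻¹ := by
  obtain ⟨α, d, hd, hα, htr⟩ := exists_sq_eq_intCast hK2
  choose c hc hpow hjac using fun p : Nat.Primes => exists_rK_prime_pow_jacobiSym hK2 hα htr p.2
  have hN : NeZero (4 * d.natAbs) := ⟨by have := Int.natAbs_ne_zero.2 hd; omega⟩
  have hfin : {p : Nat.Primes | ((p : ℕ) : ℤ) ∣ 2 * d}.Finite := by
    refine Set.Finite.of_finite_image (f := fun p : Nat.Primes => (p : ℕ)) ?_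
      Subtype.val_injective.injOn
    refine (Nat.divisors (2 * d).natAbs).finite_toSet.subset ?_
    rintro _ ⟨p, hp, rfl⟩
    simp only [Finset.mem_coe, Nat.mem_divisors]
    exact ⟨Int.natCast_dvd.1 hp, by simpa using hd⟩
  have hc1 : ∀ p, ‖(c p : ℂ)‖ ≤ 1 := fun p => by rcases hc p with h | h | h <;> simp [h]
  refine ⟨4 * d.natAbs, hN, fun j => oddJacobi d j.val, hfin.toFinset, fun p => oddJacobi d p,
    fun p => c p, fun p => norm_oddJacobi_le_one _ _, hc1, fun s hs => ?_⟩
  have hLΦ := ZMod.LFunction_eq_LSeries (fun j : ZMod (4 * d.natAbs) => oddJacobi d j.val) hs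
  have hsum := ZMod.LSeriesSummable_of_one_lt_re
    (fun j : ZMod (4 * d.natAbs) => oddJacobi d j.val) hs
  simp only [oddJacobi_val_natCast] at hLΦ hsum
  rw [hLΦ]
  have h1 := rK_eulerProduct_hasProd (K := K) hc1 (fun p k => by exact_mod_cast hpow p k) hs
  have h2 := LSeries_eulerProduct_hasProd_of_monoidWithZeroHom (oddJacobi d) hsum
  have h3 : HasProd (fun p : Nat.Primes => (1 - oddJacobi d p * (p : ℂ) ^ (-s)) *
      (1 - c p * (p : ℂ) ^ (-s))⁻¹) (∏ p ∈ hfin.toFinset, (1 - oddJacobi d p * (p : ℂ) ^ (-s)) *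
      (1 - c p * (p : ℂ) ^ (-s))⁻¹) := by
    refine hasProd_prod_of_ne_finset_one fun p hp => ?_
    have hp' : ¬ ((p : ℕ) : ℤ) ∣ 2 * d := by simpa using hp
    have hodd : Odd (p : ℕ) := by
      refine p.2.odd_of_ne_two fun h => hp' ?_
      rw [h]
      exact dvd_mul_right _ _
    rw [oddJacobi_apply, if_pos hodd, ← hjac p hp']
    exact mul_inv_cancel₀
      (one_sub_mul_ne_zero (hc1 p) (norm_prime_cpow_neg_lt_one p.2 (by linarith)))
  refine h1.unique ((((riemannZeta_eulerProduct_hasProd hs).mul h2).mul h3).congr_fun fun p => ?_)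
  have hne := one_sub_mul_ne_zero (norm_oddJacobi_le_one d p)
    (norm_prime_cpow_neg_lt_one p.2 (s := s) (by linarith))
  rw [mul_assoc, inv_mul_cancel_left₀ hne]

end

lemma norm_one_sub_mul_inv_mul_le {p : ℕ} (hp : p.Prime) {a c : ℂ} (ha : ‖a‖ ≤ 1) (hc : ‖c‖ ≤ 1)
    {s : ℂ} (hs : 1 / 2 ≤ s.re) :
    ‖(1 - a * (p : ℂ) ^ (-s)) * (1 - c * (p : ℂ) ^ (-s))⁻¹‖ ≤ 8 := by
  have hz : ‖(p : ℂ) ^ (-s)‖ ≤ 3 / 4 := by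
    rw [norm_natCast_cpow_of_pos hp.pos]
    have h2 : (2 : ℝ) ≤ p := by exact_mod_cast hp.two_le
    have h3 : (4 / 3 : ℝ) ≤ (p : ℝ) ^ (1 / 2 : ℝ) := by
      rw [← Real.sqrt_eq_rpow]
      apply Real.le_sqrt_of_sq_le
      linarith
    have h4 : (p : ℝ) ^ (1 / 2 : ℝ) ≤ (p : ℝ) ^ s.re :=
      Real.rpow_le_rpow_of_exponent_le (by linarith) hs
    rw [neg_re, Real.rpow_neg (by linarith), inv_le_comm₀ (by positivity) (by norm_num)]
    linarith
  have h1 : ∀ u : ℂ, ‖u‖ ≤ 1 → ‖u * (p : ℂ) ^ (-s)‖ ≤ 3 / 4 := fun u hu => by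
    rw [norm_mul]; exact (mul_le_of_le_one_left (norm_nonneg _) hu).trans hz
  have h2 : ‖1 - a * (p : ℂ) ^ (-s)‖ ≤ 2 := by
    have := norm_sub_le (1 : ℂ) (a * (p : ℂ) ^ (-s))
    rw [norm_one] at this
    linarith [h1 a ha]
  have h3 : 1 / 4 ≤ ‖1 - c * (p : ℂ) ^ (-s)‖ := by
    have := norm_sub_norm_le (1 : ℂ) (c * (p : ℂ) ^ (-s))
    rw [norm_one] at this
    linarith [h1 c hc]
  rw [norm_mul, norm_inv, ← div_eq_mul_inv, div_le_iff₀ (by linarith)]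
  linarith

lemma differentiableAt_one_sub_mul_inv_mul {p : ℕ} (hp : p.Prime) (a : ℂ) {c : ℂ} (hc : ‖c‖ ≤ 1)
    {s : ℂ} (hs : 0 < s.re) :
    DifferentiableAt ℂ
      (fun s : ℂ => (1 - a * (p : ℂ) ^ (-s)) * (1 - c * (p : ℂ) ^ (-s))⁻¹) s := by
  have hp0 : (p : ℂ) ≠ 0 := by exact_mod_cast hp.ne_zero
  have h : DifferentiableAt ℂ (fun s : ℂ => (p : ℂ) ^ (-s)) s :=
    differentiableAt_id.neg.const_cpow (Or.inl hp0)
  exact ((h.const_mul a).const_sub 1).mul (((h.const_mul c).const_sub 1).inv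
    (one_sub_mul_ne_zero hc (norm_prime_cpow_neg_lt_one hp hs)))

lemma one_add_log_pow_le {ε : ℝ} (hε : 0 < ε) :
    ∃ C : ℝ, 0 ≤ C ∧ ∀ x : ℝ, 1 ≤ x → (1 + Real.log x) ^ 4 ≤ C * x ^ ε := by
  refine ⟨(1 + (ε / 4)⁻¹) ^ 4, by positivity, fun x hx => ?_⟩
  have hx0 : 0 ≤ x := by linarith
  have h1 : Real.log x ≤ x ^ (ε / 4) / (ε / 4) := Real.log_le_rpow_div hx0 (by positivity)
  have h2 : 1 ≤ x ^ (ε / 4) := Real.one_le_rpow hx (by positivity)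
  have h3 : 1 + Real.log x ≤ (1 + (ε / 4)⁻¹) * x ^ (ε / 4) := by
    rw [add_mul, one_mul, inv_mul_eq_div]; linarith
  have h4 : x ^ ε = (x ^ (ε / 4)) ^ 4 := by
    rw [← Real.rpow_natCast, ← Real.rpow_mul hx0]; congr 1; push_cast; ring
  rw [h4, ← mul_pow]
  exact pow_le_pow_left₀ (by linarith [Real.log_nonneg hx]) h3 4

section
variable {K : Type*} [Field K] [NumberField K]

lemma exists_norm_dedekind_zeta_le_of_le_two (hK2 : Module.finrank ℚ K = 2) {ζK : ℂ → ℂ}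
    (hζK_holo : ∀ s : ℂ, s ≠ 1 → DifferentiableAt ℂ ζK s)
    (hζK_eq : ∀ s : ℂ, 1 < s.re → ζK s = LSeries (fun n => (rK K n : ℂ)) s) :
    ∃ C : ℝ, 0 ≤ C ∧ ∀ σ t : ℝ, 1 / 2 ≤ σ → σ ≤ 2 → 1 ≤ |t| → ‖ζK (σ + t * I)‖ ≤
      C * ((1 + Real.log |t|) ^ 4 * |t| ^ (5 / 6 * max (1 - σ) 0)) := by
  obtain ⟨N, hN, Φ, S, a, c, ha, hc, heq⟩ := exists_LSeries_rK_eq hK2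
  have hne : ∀ s : ℂ, s.im ≠ 0 → s ≠ 1 := by rintro _ h rfl; simp at h
  have key : ∀ s : ℂ, 0 < s.re → s.im ≠ 0 → ζK s = riemannZeta s * ZMod.LFunction Φ s *
      ∏ p ∈ S, (1 - a p * (p : ℂ) ^ (-s)) * (1 - c p * (p : ℂ) ^ (-s))⁻¹ := by
    intro s hs hi
    refine eq_of_eq_of_one_lt_re (g := fun s => riemannZeta s * ZMod.LFunction Φ s *
      ∏ p ∈ S, (1 - a p * (p : ℂ) ^ (-s)) * (1 - c p * (p : ℂ) ^ (-s))⁻¹)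
      (fun s _ hi => hζK_holo s (hne s hi)) (fun s hs hi => ?_)
      (fun s hs => by rw [hζK_eq s hs, heq s hs]) hs hi
    refine ((differentiableAt_riemannZeta (hne s hi)).mul
      (ZMod.differentiableAt_LFunction Φ s (Or.inl (hne s hi)))).mul ?_
    exact DifferentiableAt.fun_finsetProd fun p _ =>
      differentiableAt_one_sub_mul_inv_mul p.2 (a p) (hc p) hs
  obtain ⟨C₁, h₁⟩ := hasWeylBound_riemannZeta
  obtain ⟨C₂, h₂⟩ := hasWeylBound_LFunction Φ
  refine ⟨|C₁| * |C₂| * 8 ^ S.card, by positivity, fun σ t hσ hσ2 ht => ?_⟩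
  have hre : ((σ : ℂ) + t * I).re = σ := by simp
  have him : ((σ : ℂ) + t * I).im = t := by simp
  have ht0 : 0 < |t| := by linarith
  rw [key _ (by rw [hre]; linarith) (by rw [him]; exact abs_pos.1 ht0), norm_mul, norm_mul]
  have hL := Real.log_nonneg ht
  have hX : 0 ≤ (1 + Real.log |t|) ^ 2 * |t| ^ (5 / 12 * max (1 - σ) 0) := by positivity
  have e₁ := (h₁ σ t hσ hσ2 ht).trans (mul_le_mul_of_nonneg_right (le_abs_self C₁) hX)
  have e₂ := (h₂ σ t hσ hσ2 ht).trans (mul_le_mul_of_nonneg_right (le_abs_self C₂) hX)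
  have e₃ : ‖∏ p ∈ S, (1 - a p * (p : ℂ) ^ (-((σ : ℂ) + t * I))) *
      (1 - c p * (p : ℂ) ^ (-((σ : ℂ) + t * I)))⁻¹‖ ≤ 8 ^ S.card := by
    rw [norm_prod, ← Finset.prod_const]
    exact Finset.prod_le_prod (fun _ _ => norm_nonneg _) fun p _ =>
      norm_one_sub_mul_inv_mul_le p.2 (ha p) (hc p) (by rw [hre]; exact hσ)
  calc _ ≤ (|C₁| * ((1 + Real.log |t|) ^ 2 * |t| ^ (5 / 12 * max (1 - σ) 0))) *
        (|C₂| * ((1 + Real.log |t|) ^ 2 * |t| ^ (5 / 12 * max (1 - σ) 0))) * 8 ^ S.card := by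
        gcongr
    _ = |C₁| * |C₂| * 8 ^ S.card * ((1 + Real.log |t|) ^ 4 *
        (|t| ^ (5 / 12 * max (1 - σ) 0) * |t| ^ (5 / 12 * max (1 - σ) 0))) := by ring
    _ = _ := by
        rw [← Real.rpow_add ht0, show 5 / 12 * max (1 - σ) 0 + 5 / 12 * max (1 - σ) 0 =
          5 / 6 * max (1 - σ) 0 by ring]

end

/-- For a quadratic number field `K` and fixed `ε > 0`,
`ζK (σ + it) ≪_{K,ε} 1 + |t| ^ ((5/6)(1-σ) + ε)`, uniformly for `σ ≥ 1/2`, `|t| ≥ 1`. -/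
theorem dedekind_zeta_quadratic_convexity_bound
    (K : Type) [Field K] [NumberField K] (hK2 : Module.finrank ℚ K = 2)
    (ζK : ℂ → ℂ)
    (hζK_holo : ∀ s : ℂ, s ≠ 1 → DifferentiableAt ℂ ζK s)
    (hζK_eq : ∀ s : ℂ, 1 < s.re → ζK s = LSeries (fun n => (rK K n : ℂ)) s)
    (ε : ℝ) (hε : 0 < ε) :
    ∃ C : ℝ, ∀ σ t : ℝ, 1 / 2 ≤ σ → 1 ≤ |t| →
      ‖ζK (σ + t * Complex.I)‖ ≤ C * (1 + |t| ^ (5 / 6 * (1 - σ) + ε)) := by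
  obtain ⟨C₁, hC₁, h₁⟩ := exists_norm_dedekind_zeta_le_of_le_two hK2 hζK_holo hζK_eq
  obtain ⟨C₂, hC₂, h₂⟩ := one_add_log_pow_le (ε := ε / 6) (by positivity)
  set δ : ℝ := min ε 1 with hδ
  have hδ0 : 0 < δ := lt_min hε one_pos
  set M : ℝ := ∑' n : ℕ, ‖LSeries.term (fun n => (rK K n : ℂ)) ((1 + δ : ℝ) : ℂ) n‖ with hM
  have hM0 : 0 ≤ M := tsum_nonneg fun n => norm_nonneg _
  refine ⟨C₁ * C₂ + M, fun σ t hσ ht => ?_⟩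
  have ht0 : 0 < |t| := by linarith
  have hre : ((σ : ℂ) + t * I).re = σ := by simp
  have hR : 0 ≤ |t| ^ (5 / 6 * (1 - σ) + ε) := by positivity
  rcases le_total (1 + δ) σ with h | h
  · have hs : 1 < ((σ : ℂ) + t * I).re := by rw [hre]; linarith
    have hM1 : ‖ζK (σ + t * I)‖ ≤ M := by
      rw [hζK_eq _ hs]
      have hsum := (LSeriesSummable_rK (K := K) hs).norm
      refine (norm_tsum_le_tsum_norm hsum).trans (hsum.tsum_le_tsum (fun n => ?_)
        (LSeriesSummable_rK (K := K) (s := ((1 + δ : ℝ) : ℂ)) (by simpa using hδ0)).norm)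
      exact LSeries.norm_term_le_of_re_le_re _ (by simpa using h) n
    nlinarith [mul_nonneg hC₁ hC₂, mul_nonneg (mul_nonneg hC₁ hC₂) hR, mul_nonneg hM0 hR]
  · have hδε : δ ≤ ε := min_le_left _ _
    have hδ1 : δ ≤ 1 := min_le_right _ _
    have hexp : ε / 6 + 5 / 6 * max (1 - σ) 0 ≤ 5 / 6 * (1 - σ) + ε := by
      rcases le_total (1 - σ) 0 with h' | h'
      · rw [max_eq_right h']; linarith
      · rw [max_eq_left h']; linarith
    have hle : ‖ζK (σ + t * I)‖ ≤ C₁ * C₂ * |t| ^ (5 / 6 * (1 - σ) + ε) :=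
      calc _ ≤ C₁ * ((1 + Real.log |t|) ^ 4 * |t| ^ (5 / 6 * max (1 - σ) 0)) :=
            h₁ σ t hσ (by linarith) ht
        _ ≤ C₁ * ((C₂ * |t| ^ (ε / 6)) * |t| ^ (5 / 6 * max (1 - σ) 0)) := by
            gcongr; exact h₂ _ ht
        _ = C₁ * C₂ * |t| ^ (ε / 6 + 5 / 6 * max (1 - σ) 0) := by
            rw [Real.rpow_add ht0]; ring
        _ ≤ _ := by gcongr
    nlinarith [mul_nonneg hC₁ hC₂, mul_nonneg hM0 hR]
end

section
/- Let K be a number field of degree [K:ℚ] ≥ 1 with ring of integers O_K. Then, as X → ∞, ∑_{P : N(P) ≤ X} N(P)^{-1} = log log X + O(1), where the sum runs over the nonzero prime ideals P of O_K of absolute norm N(P) at most X. -/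
open Complex Filter Asymptotics

open UniqueFactorizationMonoid in
/-- A finite product `∏ (1 + f p)` over primes is a partial sum of `∑ f a`, by unique
factorization. -/
theorem prod_one_add_le_tsum_of_prime {M : Type*} [CommMonoidWithZero M]
    [UniqueFactorizationMonoid M] [Subsingleton Mˣ] (f : M →*₀ ℝ)
    (hf : ∀ a, 0 ≤ f a) (hs : Summable f) (S : Finset {p : M // Prime p}) :
    ∏ p ∈ S, (1 + f p) ≤ ∑' a, f a := by
  classical
  rw [Finset.prod_one_add]
  have hinj : Set.InjOn (fun T : Finset {p : M // Prime p} ↦ ∏ p ∈ T, (p : M)) S.powerset := by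
    intro T _ T' _ h
    have key (U : Finset {p : M // Prime p}) :
        normalizedFactors (∏ p ∈ U, (p : M)) = U.val.map (↑) := by
      rw [Finset.prod_eq_multiset_prod]
      refine normalizedFactors_prod_of_prime fun p hp ↦ ?_
      obtain ⟨q, -, rfl⟩ := Multiset.mem_map.1 hp
      exact q.2
    have := congrArg normalizedFactors h
    simp only [key] at this
    exact Finset.val_injective (Multiset.map_injective Subtype.val_injective this)
  calc ∑ T ∈ S.powerset, ∏ p ∈ T, f p
      = ∑ a ∈ S.powerset.image (fun T : Finset {p : M // Prime p} ↦ ∏ p ∈ T, (p : M)), f a := by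
        rw [Finset.sum_image hinj]
        simp
    _ ≤ ∑' a, f a := hs.sum_le_tsum _ fun a _ ↦ hf a

open UniqueFactorizationMonoid in
/-- Every finite partial sum of `∑ f a` is bounded by a finite partial Euler product. -/
theorem exists_sum_le_prod_one_sub_inv_of_prime {M : Type*} [CommMonoidWithZero M]
    [UniqueFactorizationMonoid M] [Subsingleton Mˣ] (f : M →*₀ ℝ)
    (hf : ∀ a, 0 ≤ f a) (hlt : ∀ p, Prime p → f p < 1) (A : Finset M) :
    ∃ S : Finset {p : M // Prime p}, ∑ a ∈ A, f a ≤ ∏ p ∈ S, (1 - f p)⁻¹ := by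
  classical
  wlog hA : 0 ∉ A generalizing A
  · obtain ⟨S, hS⟩ := this (A.erase 0) (by simp)
    exact ⟨S, by rwa [Finset.sum_erase _ (map_zero f)] at hS⟩
  let S : Finset {p : M // Prime p} :=
    (A.biUnion fun a ↦ (normalizedFactors a).toFinset).subtype Prime
  let n : ℕ := (A.sup fun a ↦ (normalizedFactors a).card) + 1
  let e : M → S → ℕ := fun a p ↦ (normalizedFactors a).count (p : M)
  have hprod {a : M} (ha : a ∈ A) : a = ∏ p : S, (p : M) ^ e a p := by
    have ha0 : a ≠ 0 := fun h ↦ hA (h ▸ ha)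
    rw [Finset.prod_coe_sort S (fun p ↦ (p : M) ^ (normalizedFactors a).count (p : M))]
    refine Eq.trans ?_ (Finset.prod_map S (Function.Embedding.subtype Prime)
      (fun p ↦ p ^ (normalizedFactors a).count p))
    rw [← Finset.prod_multiset_count_of_subset]
    · exact (associated_iff_eq.1 (prod_normalizedFactors ha0)).symm
    · intro p hp
      rw [Multiset.mem_toFinset] at hp
      simp only [Finset.mem_map, S, Finset.mem_subtype, Finset.mem_biUnion, Multiset.mem_toFinset]
      exact ⟨⟨p, prime_of_normalized_factor p hp⟩, ⟨a, ha, hp⟩, rfl⟩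
  have hinj : Set.InjOn e A := fun a ha b hb h ↦ by rw [hprod ha, hprod hb, h]
  refine ⟨S, ?_⟩
  calc ∑ a ∈ A, f a = ∑ x ∈ A.image e, ∏ p : S, f (p : M) ^ x p := by
        rw [Finset.sum_image hinj]
        refine Finset.sum_congr rfl fun a ha ↦ ?_
        conv_lhs => rw [hprod ha]
        simp
    _ ≤ ∑ x ∈ Fintype.piFinset fun _ : S ↦ Finset.range n, ∏ p : S, f (p : M) ^ x p := by
        refine Finset.sum_le_sum_of_subset_of_nonneg ?_ fun x _ _ ↦
          Finset.prod_nonneg fun p _ ↦ pow_nonneg (hf _) _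
        refine Finset.image_subset_iff.2 fun a ha ↦ Fintype.mem_piFinset.2 fun p ↦ ?_
        rw [Finset.mem_range, Nat.lt_succ_iff]
        exact (Multiset.count_le_card _ _).trans
          (Finset.le_sup (f := fun a ↦ (normalizedFactors a).card) ha)
    _ = ∏ p : S, ∑ k ∈ Finset.range n, f (p : M) ^ k := (Finset.prod_univ_sum _ _).symm
    _ ≤ ∏ p : S, (1 - f (p : M))⁻¹ := by
        refine Finset.prod_le_prod (fun p _ ↦ Finset.sum_nonneg fun k _ ↦ pow_nonneg (hf _) _)
          fun p _ ↦ ?_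
        rw [← tsum_geometric_of_lt_one (hf _) (hlt _ p.1.2)]
        exact (summable_geometric_of_lt_one (hf _) (hlt _ p.1.2)).sum_le_tsum _
          fun k _ ↦ pow_nonneg (hf _) _
    _ = ∏ p ∈ S, (1 - f p)⁻¹ := Finset.prod_coe_sort S fun p ↦ (1 - f (p : M))⁻¹

/-- The logarithm of `∑ f a` is the sum of `f` over the primes, up to the contribution of the
squares. -/
theorem abs_log_tsum_sub_tsum_prime_le {M : Type*} [CommMonoidWithZero M]
    [UniqueFactorizationMonoid M] [Subsingleton Mˣ] (f : M →*₀ ℝ)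
    (hf : ∀ a, 0 ≤ f a) (hs : Summable f) (hle : ∀ p, Prime p → f p ≤ 1 / 2) :
    |Real.log (∑' a, f a) - ∑' p : {p : M // Prime p}, f p| ≤
      2 * ∑' p : {p : M // Prime p}, f p ^ 2 := by
  have hs₁ : Summable fun p : {p : M // Prime p} ↦ f p := hs.subtype _
  have hs₂ : Summable fun p : {p : M // Prime p} ↦ f p ^ 2 :=
    hs₁.of_nonneg_of_le (fun p ↦ sq_nonneg _) fun p ↦ by nlinarith [hf p, hle p p.2]
  have hZ : 1 ≤ ∑' a, f a := by simpa using hs.le_tsum 1 fun a _ ↦ hf a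
  have hB : 0 ≤ ∑' p : {p : M // Prime p}, f p ^ 2 := tsum_nonneg fun p ↦ sq_nonneg _
  have lower : ∑' p : {p : M // Prime p}, f p - ∑' p : {p : M // Prime p}, f p ^ 2 ≤
      Real.log (∑' a, f a) := by
    rw [← hs₁.tsum_sub hs₂]
    refine (hs₁.sub hs₂).tsum_le_of_sum_le fun S ↦ ?_
    rw [Real.le_log_iff_exp_le (by linarith), Real.exp_sum]
    refine le_trans (Finset.prod_le_prod (fun p _ ↦ (Real.exp_pos _).le) fun p _ ↦ ?_)
      (prod_one_add_le_tsum_of_prime f hf hs S)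
    have hp := hf p
    rw [← Real.le_log_iff_exp_le (by linarith)]
    refine le_trans ?_ (Real.one_sub_inv_le_log_of_pos (by linarith))
    rw [← sub_nonneg]
    have : 1 - (1 + f p)⁻¹ - (f p - f p ^ 2) = f p ^ 3 / (1 + f p) := by field_simp; ring
    rw [this]
    positivity
  have upper : Real.log (∑' a, f a) ≤
      ∑' p : {p : M // Prime p}, f p + 2 * ∑' p : {p : M // Prime p}, f p ^ 2 := by
    rw [Real.log_le_iff_le_exp (by linarith)]
    refine hs.tsum_le_of_sum_le fun A ↦ ?_
    obtain ⟨S, hS⟩ := exists_sum_le_prod_one_sub_inv_of_prime f hf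
      (fun p hp ↦ (hle p hp).trans_lt (by norm_num)) A
    refine hS.trans ?_
    rw [← tsum_mul_left, ← hs₁.tsum_add (hs₂.mul_left 2)]
    refine le_trans ?_ (Real.exp_le_exp.2 ((hs₁.add (hs₂.mul_left 2)).sum_le_tsum S
      fun p _ ↦ add_nonneg (hf _) (by positivity)))
    rw [Real.exp_sum]
    refine Finset.prod_le_prod (fun p _ ↦ inv_nonneg.2 (by linarith [hle p p.2])) fun p _ ↦ ?_
    have hp := hf p
    have hp' := hle p p.2
    rw [← Real.log_le_iff_le_exp (inv_pos.2 (by linarith))]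
    refine (Real.log_le_sub_one_of_pos (inv_pos.2 (by linarith))).trans ?_
    rw [← sub_nonneg]
    have h1 : 1 - f p ≠ 0 := by linarith
    have : f p + 2 * f p ^ 2 - ((1 - f p)⁻¹ - 1) = f p ^ 2 * (1 - 2 * f p) / (1 - f p) := by
      field_simp; ring
    rw [this]
    exact div_nonneg (mul_nonneg (sq_nonneg _) (by linarith)) (by linarith)
  rw [abs_le]
  constructor <;> linarith

theorem abs_indicator_sub_exp_neg_le {t : ℝ} (ht : 0 ≤ t) :
    |(if t ≤ 1 then 1 else 0) - Real.exp (-t)| ≤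
      Real.exp 1 * (Real.exp (-t) - Real.exp (-(2 * t))) := by
  have hsq : Real.exp (-(2 * t)) = Real.exp (-t) * Real.exp (-t) := by
    rw [← Real.exp_add]; ring_nf
  have he1 : Real.exp 1 * Real.exp (-1) = 1 := by rw [← Real.exp_add]; simp
  have hpos := Real.exp_pos (-t)
  have h2 : 2 ≤ Real.exp 1 := by linarith [Real.add_one_le_exp 1]
  have hle : Real.exp (-t) ≤ 1 := Real.exp_le_one_iff.2 (by linarith)
  rw [hsq]
  split_ifs with h
  · have : Real.exp (-1) ≤ Real.exp (-t) := Real.exp_le_exp.2 (by linarith)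
    have : 1 ≤ Real.exp 1 * Real.exp (-t) := by nlinarith
    rw [abs_of_nonneg (by linarith)]
    nlinarith
  · have : Real.exp (-t) ≤ Real.exp (-1) := Real.exp_le_exp.2 (by linarith)
    have : Real.exp 1 * Real.exp (-t) ≤ 1 := by nlinarith
    rw [zero_sub, abs_neg, abs_of_nonneg hpos.le]
    nlinarith

/-- A Tauberian principle: if `∑ q⁻¹⁻ᵟ = log (1 / δ) + O(1)` as `δ → 0⁺`, then
`∑_{q ≤ X} q⁻¹ = log log X + O(1)` as `X → ∞`. -/
theorem isBigO_tsum_inv_sub_log_log {ι : Type*} (q : ι → ℝ) (hq : ∀ i, 1 ≤ q i)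
    (hs : ∀ δ : ℝ, 0 < δ → Summable fun i ↦ q i ^ (-(1 + δ)))
    (hO : (fun δ : ℝ ↦ ∑' i, q i ^ (-(1 + δ)) + Real.log δ) =O[nhdsWithin 0 (Set.Ioi 0)]
      fun _ ↦ (1 : ℝ)) :
    (fun X : ℝ ↦ ∑' i, (if q i ≤ X then (q i)⁻¹ else 0) - Real.log (Real.log X)) =O[atTop]
      fun _ ↦ (1 : ℝ) := by
  have hδ : Tendsto (fun X ↦ (Real.log X)⁻¹) atTop (nhdsWithin 0 (Set.Ioi 0)) :=
    tendsto_inv_atTop_nhdsGT_zero.comp Real.tendsto_log_atTop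
  have h2 : Tendsto (fun δ : ℝ ↦ 2 * δ) (nhdsWithin 0 (Set.Ioi 0)) (nhdsWithin 0 (Set.Ioi 0)) := by
    refine tendsto_nhdsWithin_iff.2 ⟨?_, ?_⟩
    · exact ((continuous_const_mul 2).tendsto' 0 0 (by simp)).mono_left nhdsWithin_le_nhds
    · filter_upwards [self_mem_nhdsWithin] with δ h
      exact mul_pos two_pos (Set.mem_Ioi.1 h)
  have hdiff : (fun δ : ℝ ↦ ∑' i, q i ^ (-(1 + δ)) - ∑' i, q i ^ (-(1 + 2 * δ)))
      =O[nhdsWithin 0 (Set.Ioi 0)] fun _ ↦ (1 : ℝ) := by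
    have hlog := isBigO_const_const (Real.log 2) (one_ne_zero (α := ℝ))
      (nhdsWithin (0 : ℝ) (Set.Ioi 0))
    refine ((hO.sub (hO.comp_tendsto h2)).add hlog).congr' ?_ EventuallyEq.rfl
    filter_upwards [self_mem_nhdsWithin] with δ h
    simp only [Function.comp_apply]
    rw [Real.log_mul two_ne_zero (ne_of_gt h)]
    ring
  have hclose : (fun X : ℝ ↦ ∑' i, (if q i ≤ X then (q i)⁻¹ else 0) -
      ∑' i, q i ^ (-(1 + (Real.log X)⁻¹))) =O[atTop] fun _ ↦ (1 : ℝ) := by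
    refine IsBigO.trans ?_ (hdiff.comp_tendsto hδ)
    refine IsBigO.of_bound (Real.exp 1) ?_
    filter_upwards [eventually_gt_atTop 1] with X hX
    have hL : 0 < Real.log X := Real.log_pos hX
    set δ := (Real.log X)⁻¹ with hδdef
    have hδ0 : 0 < δ := inv_pos.2 hL
    have hs₁ := hs δ hδ0
    have hs₂ := hs (2 * δ) (by positivity)
    have hbound (i : ι) : ‖(if q i ≤ X then (q i)⁻¹ else 0) - q i ^ (-(1 + δ))‖ ≤
        Real.exp 1 * (q i ^ (-(1 + δ)) - q i ^ (-(1 + 2 * δ))) := by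
      have hqi : 0 < q i := one_pos.trans_le (hq i)
      have hrpow (c : ℝ) : q i ^ (-(1 + c)) = (q i)⁻¹ * Real.exp (-(c * Real.log (q i))) := by
        rw [neg_add, Real.rpow_add hqi, Real.rpow_neg_one, Real.rpow_def_of_pos hqi]
        ring_nf
      have hiff : q i ≤ X ↔ δ * Real.log (q i) ≤ 1 := by
        rw [hδdef, inv_mul_le_one₀ hL, Real.log_le_log_iff hqi (by linarith)]
      have key := abs_indicator_sub_exp_neg_le (mul_nonneg hδ0.le (Real.log_nonneg (hq i)))
      have hite : (if q i ≤ X then (q i)⁻¹ else 0) =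
          (q i)⁻¹ * (if δ * Real.log (q i) ≤ 1 then 1 else 0) := by
        simp only [hiff, mul_ite, mul_one, mul_zero]
      rw [hite, hrpow, hrpow, ← mul_sub, ← mul_sub, norm_mul, Real.norm_eq_abs, Real.norm_eq_abs,
        abs_of_pos (inv_pos.2 hqi), mul_left_comm, mul_assoc 2]
      exact mul_le_mul_of_nonneg_left key (inv_pos.2 hqi).le
    have hsd := (hs₁.sub hs₂).mul_left (Real.exp 1)
    have hs₀ : Summable fun i ↦ if q i ≤ X then (q i)⁻¹ else 0 := by
      simpa using (Summable.of_norm_bounded hsd hbound).add hs₁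
    rw [← hs₀.tsum_sub hs₁]
    refine (tsum_of_norm_bounded hsd.hasSum hbound).trans ?_
    rw [tsum_mul_left, hs₁.tsum_sub hs₂]
    exact mul_le_mul_of_nonneg_left (Real.le_norm_self _) (Real.exp_pos _).le
  refine (hclose.add (hO.comp_tendsto hδ)).congr_left fun X ↦ ?_
  simp only [Function.comp_apply, Real.log_inv]
  ring

open NumberField

/-- The map `I ↦ N(I)⁻ˢ` on ideals, as a monoid homomorphism with zero. -/
noncomputable def absNormRpowNeg (K : Type*) [Field K] [NumberField K] (s : ℝ) (hs : s ≠ 0) :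
    Ideal (𝓞 K) →*₀ ℝ where
  toFun I := (Ideal.absNorm I : ℝ) ^ (-s)
  map_zero' := by simp [hs]
  map_one' := by simp
  map_mul' I J := by simp [Real.mul_rpow]

/-- The number of nonzero ideals of norm at most `n` is `O(n)`. -/
theorem sum_card_absNorm_eq_isBigO (K : Type*) [Field K] [NumberField K] :
    (fun n : ℕ ↦ ∑ k ∈ Finset.Icc 1 n, (Nat.card {I : Ideal (𝓞 K) // Ideal.absNorm I = k} : ℝ))
      =O[atTop] fun n ↦ (n : ℝ) ^ (1 : ℝ) := by
  have h := ((Ideal.tendsto_norm_le_div_atTop K).comp tendsto_natCast_atTop_atTop).isBigO_one ℝ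
  have hn := isBigO_refl (fun n : ℕ ↦ (n : ℝ)) atTop
  have h' : (fun n : ℕ ↦ (Nat.card {I : Ideal (𝓞 K) // Ideal.absNorm I ≤ n} : ℝ))
      =O[atTop] fun n ↦ (n : ℝ) := by
    refine (h.mul hn).congr' ?_ (by simp)
    filter_upwards [eventually_ne_atTop 0] with n hn0
    have : (n : ℝ) ≠ 0 := by exact_mod_cast hn0
    simp [this]
  simp only [Real.rpow_one]
  refine (IsBigO.of_bound 1 (Eventually.of_forall fun n ↦ ?_)).trans h'
  have hle : ∑ k ∈ Finset.Icc 1 n, Nat.card {I : Ideal (𝓞 K) // Ideal.absNorm I = k} ≤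
      Nat.card {I : Ideal (𝓞 K) // Ideal.absNorm I ≤ n} := by
    have := Finset.card_preimage_eq_sum_card_image_eq (f := fun I : Ideal (𝓞 K) ↦ Ideal.absNorm I)
      (s := Finset.Icc 0 n) fun k _ ↦ Ideal.finite_setOfPred_absNorm_eq k
    refine (Finset.sum_le_sum_of_subset (Finset.Icc_subset_Icc_left zero_le_one)).trans ?_
    refine (this.symm.le.trans_eq ?_)
    simp [Set.coe_eq_subtype]
  rw [one_mul, Real.norm_of_nonneg (by positivity), Real.norm_of_nonneg (by positivity)]
  exact_mod_cast hle

/-- For real `s > 1`, the Dedekind zeta function is the sum of `N(I)⁻ˢ` over all ideals; the zero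
ideal contributes `0`. -/
theorem hasSum_absNorm_rpow_neg (K : Type*) [Field K] [NumberField K] {s : ℝ} (hs : 1 < s) :
    HasSum (fun I : Ideal (𝓞 K) ↦ (Ideal.absNorm I : ℝ) ^ (-s)) (dedekindZeta K s).re := by
  have hs0 : s ≠ 0 := by linarith
  let c : ℕ → ℝ := fun n ↦ Nat.card {I : Ideal (𝓞 K) // Ideal.absNorm I = n}
  have hL : HasSum (LSeries.term (fun n ↦ (c n : ℂ)) s) (dedekindZeta K s) := by
    have := (LSeriesSummable_of_sum_norm_bigO_and_nonneg (sum_card_absNorm_eq_isBigO K)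
      (fun _ ↦ Nat.cast_nonneg _) zero_le_one (s := (s : ℂ)) (by simpa using hs)).LSeriesHasSum
    simpa [LSeriesHasSum, dedekindZeta, c] using this
  have hterm : HasSum (fun n : ℕ ↦ c n * (n : ℝ) ^ (-s)) (dedekindZeta K s).re := by
    refine (Complex.hasSum_re hL).congr_fun fun n ↦ ?_
    rcases eq_or_ne n 0 with rfl | hn
    · simp [hs0]
    · rw [LSeries.term_of_ne_zero hn, Real.rpow_neg (Nat.cast_nonneg _), ← div_eq_mul_inv,
        ← Complex.ofReal_natCast, ← Complex.ofReal_cpow (Nat.cast_nonneg _), ← Complex.ofReal_div,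
        Complex.ofReal_re]
  have hfiber (n : ℕ) : HasSum
      (fun I : {I : Ideal (𝓞 K) // Ideal.absNorm I = n} ↦ (Ideal.absNorm I.1 : ℝ) ^ (-s))
      (c n * (n : ℝ) ^ (-s)) := by
    have : Finite {I : Ideal (𝓞 K) // Ideal.absNorm I = n} := Ideal.finite_setOfPred_absNorm_eq n
    have := Fintype.ofFinite {I : Ideal (𝓞 K) // Ideal.absNorm I = n}
    have hsum : ∑ I : {I : Ideal (𝓞 K) // Ideal.absNorm I = n}, (Ideal.absNorm I.1 : ℝ) ^ (-s) =
        c n * (n : ℝ) ^ (-s) := by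
      rw [Finset.sum_congr rfl fun I _ ↦ by rw [I.2]]
      simp [c]
    exact hsum ▸ hasSum_fintype _
  rw [← (Equiv.sigmaFiberEquiv fun I : Ideal (𝓞 K) ↦ Ideal.absNorm I).hasSum_iff]
  refine HasSum.sigma_of_hasSum hterm hfiber ((summable_sigma_of_nonneg fun _ ↦
    Real.rpow_nonneg (Nat.cast_nonneg _) _).2 ⟨fun n ↦ (hfiber n).summable, ?_⟩)
  exact hterm.summable.congr fun n ↦ (hfiber n).tsum_eq.symm

/-- As `δ → 0⁺`, the prime ideal zeta sum at `1 + δ` is `log (1 / δ) + O(1)`. -/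
theorem tsum_prime_absNorm_rpow_add_log_isBigO (K : Type*) [Field K] [NumberField K] :
    (fun δ : ℝ ↦ ∑' P : {P : Ideal (𝓞 K) // Prime P}, (Ideal.absNorm P.1 : ℝ) ^ (-(1 + δ)) +
      Real.log δ) =O[nhdsWithin 0 (Set.Ioi 0)] fun _ ↦ (1 : ℝ) := by
  have hres : Tendsto (fun δ : ℝ ↦ δ * (dedekindZeta K ((1 + δ : ℝ) : ℂ)).re)
      (nhdsWithin 0 (Set.Ioi 0)) (nhds (dedekindZeta_residue K)) := by
    have hshift : Tendsto (fun δ : ℝ ↦ 1 + δ) (nhdsWithin 0 (Set.Ioi 0))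
        (nhdsWithin 1 (Set.Ioi 1)) := by
      refine tendsto_nhdsWithin_iff.2 ⟨?_, ?_⟩
      · exact ((continuous_const_add 1).tendsto' 0 1 (by simp)).mono_left nhdsWithin_le_nhds
      · filter_upwards [self_mem_nhdsWithin] with δ h
        simpa using h
    have := (Complex.continuous_re.tendsto _).comp
      ((tendsto_sub_one_mul_dedekindZeta_nhdsGT K).comp hshift)
    refine this.congr fun δ ↦ ?_
    simp only [Function.comp_apply]
    rw [show ((1 + δ : ℝ) : ℂ) - 1 = (δ : ℂ) by push_cast; ring, Complex.re_ofReal_mul]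
  have hlog := ((Real.continuousAt_log (dedekindZeta_residue_ne_zero K)).tendsto.comp
    hres).isBigO_one ℝ
  have hnorm {P : Ideal (𝓞 K)} (hP : Prime P) : 2 ≤ (Ideal.absNorm P : ℝ) := by
    have h0 := Ideal.absNorm_eq_zero_iff.not.2 hP.ne_zero
    have h1 := Ideal.absNorm_eq_one_iff.not.2 (Ideal.isPrime_of_prime hP).ne_top
    exact_mod_cast (by lia : 2 ≤ Ideal.absNorm P)
  have hE : (fun δ : ℝ ↦ Real.log (dedekindZeta K ((1 + δ : ℝ) : ℂ)).re -
      ∑' P : {P : Ideal (𝓞 K) // Prime P}, (Ideal.absNorm P.1 : ℝ) ^ (-(1 + δ)))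
      =O[nhdsWithin 0 (Set.Ioi 0)] fun _ ↦ (1 : ℝ) := by
    refine IsBigO.of_bound (2 * ∑' P : {P : Ideal (𝓞 K) // Prime P},
      (Ideal.absNorm P.1 : ℝ) ^ (-2 : ℝ)) ?_
    filter_upwards [self_mem_nhdsWithin] with δ hδ
    rw [Set.mem_Ioi] at hδ
    have hsum := hasSum_absNorm_rpow_neg K (s := 1 + δ) (by linarith)
    have key := abs_log_tsum_sub_tsum_prime_le (absNormRpowNeg K (1 + δ) (by linarith))
      (fun I ↦ Real.rpow_nonneg (Nat.cast_nonneg _) _) hsum.summable (fun P hP ↦ ?_)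
    · change |Real.log (∑' I : Ideal (𝓞 K), (Ideal.absNorm I : ℝ) ^ (-(1 + δ))) -
        ∑' P : {P : Ideal (𝓞 K) // Prime P}, (Ideal.absNorm P.1 : ℝ) ^ (-(1 + δ))| ≤
        2 * ∑' P : {P : Ideal (𝓞 K) // Prime P}, ((Ideal.absNorm P.1 : ℝ) ^ (-(1 + δ))) ^ 2 at key
      rw [hsum.tsum_eq] at key
      rw [Real.norm_eq_abs, norm_one, mul_one]
      refine key.trans (mul_le_mul_of_nonneg_left ?_ two_pos.le)
      have hle (P : {P : Ideal (𝓞 K) // Prime P}) : ((Ideal.absNorm P.1 : ℝ) ^ (-(1 + δ))) ^ 2 ≤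
          (Ideal.absNorm P.1 : ℝ) ^ (-2 : ℝ) := by
        have := hnorm P.2
        rw [← Real.rpow_natCast, ← Real.rpow_mul (by linarith)]
        exact Real.rpow_le_rpow_of_exponent_le (by linarith) (by push_cast; linarith)
      have hs₂ := (hasSum_absNorm_rpow_neg K (s := 2) (by norm_num)).summable.subtype
        {P : Ideal (𝓞 K) | Prime P}
      exact (hs₂.of_nonneg_of_le (fun P ↦ sq_nonneg _) hle).tsum_le_tsum hle hs₂
    · have := hnorm hP
      calc (Ideal.absNorm P : ℝ) ^ (-(1 + δ)) ≤ (Ideal.absNorm P : ℝ) ^ (-1 : ℝ) :=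
            Real.rpow_le_rpow_of_exponent_le (by linarith) (by linarith)
        _ ≤ 1 / 2 := by
            rw [Real.rpow_neg_one, one_div]
            exact inv_anti₀ two_pos this
  refine (hlog.sub hE).congr' ?_ EventuallyEq.rfl
  filter_upwards [self_mem_nhdsWithin, hres.eventually_ne (dedekindZeta_residue_ne_zero K)]
    with δ hδ hne
  simp only [Function.comp_apply]
  rw [Real.log_mul (left_ne_zero_of_mul hne) (right_ne_zero_of_mul hne)]
  ring

open scoped Classical in
/-- **Mertens' theorem for prime ideals.** For a number field `K` of degree `≥ 1`,
`∑_{N(P) ≤ X} N(P)⁻¹ = log log X + O(1)` as `X → ∞`, the sum running over the nonzero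
prime ideals `P` of the ring of integers of `K` of absolute norm at most `X`. -/
theorem mertens_sum_prime_ideals
    (K : Type) [Field K] [NumberField K] (hK : 1 ≤ Module.finrank ℚ K) :
    (fun X : ℝ =>
        (∑' P : {P : Ideal (NumberField.RingOfIntegers K) // P.IsPrime ∧ P ≠ ⊥},
          if (Ideal.absNorm P.1 : ℝ) ≤ X then ((Ideal.absNorm P.1 : ℝ))⁻¹ else 0)
        - Real.log (Real.log X)) =O[atTop] (fun _ : ℝ => (1 : ℝ)) := by
  have hprime (P : Ideal (𝓞 K)) : Prime P ↔ P.IsPrime ∧ P ≠ ⊥ :=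
    ⟨fun h ↦ ⟨Ideal.isPrime_of_prime h, h.ne_zero⟩, fun h ↦ Ideal.prime_of_isPrime h.2 h.1⟩
  have h := isBigO_tsum_inv_sub_log_log
    (fun P : {P : Ideal (𝓞 K) // Prime P} ↦ (Ideal.absNorm P.1 : ℝ))
    (fun P ↦ Nat.one_le_cast.2 <| Nat.one_le_iff_ne_zero.2 <|
      Ideal.absNorm_eq_zero_iff.not.2 P.2.ne_zero)
    (fun δ hδ ↦ (hasSum_absNorm_rpow_neg K (by linarith)).summable.subtype
      {P : Ideal (𝓞 K) | Prime P}) (tsum_prime_absNorm_rpow_add_log_isBigO K)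
  refine h.congr_left fun X ↦ ?_
  congr 1
  exact (Equiv.subtypeEquivRight hprime).tsum_eq
    fun P : {P : Ideal (𝓞 K) // P.IsPrime ∧ P ≠ ⊥} ↦
      if (Ideal.absNorm P.1 : ℝ) ≤ X then (Ideal.absNorm P.1 : ℝ)⁻¹ else 0
end
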